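/- arXiv:1704.08182 — 3 statements merged into one kernel-verified Lean document; each statement's English description precedes it below -/
import Mathlib

section
/- With the $k$-SUM adversary-matrix construction (and $n>k$), the stacked matrix $\Gamma$ (rows indexed by pairs $(V,x)$ with $V$ a $k$-subset of $\{1,\dots,n\}$ and $x\in P_V$, columns indexed by $D$, $\Gamma[(V,x),y]=G_V[x,y]$) satisfies $\|\Gamma\|^2 \le n^{2k/(k+1)}\left(1 + \frac{k^2\, n^{k/(k+1)}}{n-k+1}\right)$; in particular, for each fixed $k$ there is a constant $C$ such that $\|\Gamma\| \le \left(1+C\,n^{-1/(k+1)}\right) n^{k/(k+1)}$ for all $n>k$. -/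
noncomputable section

namespace KSum

/-- `ω = e^{2πi/m}`, a primitive `m`-th root of unity. -/
def ω (m : ℕ) : ℂ := Complex.exp (2 * Real.pi * Complex.I / m)

/-- The Fourier basis vector `e_i ∈ ℂ^{ℤ/mℤ}`: `e_i[j] = ω^{ij}/√m`. -/
def eBase (m : ℕ) [NeZero m] (i : ZMod m) : ZMod m → ℂ :=
  fun j => ω m ^ (i * j).val / Real.sqrt m

/-- The Fourier basis vector `e_v = e_{v_1} ⊗ ⋯ ⊗ e_{v_n} ∈ ℂ^D`, `D = (ℤ/mℤ)ⁿ`. -/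
def eVec {n : ℕ} (m : ℕ) [NeZero m] (v : Fin n → ZMod m) : (Fin n → ZMod m) → ℂ :=
  fun x => ∏ j, eBase m (v j) (x j)

/-- The support of `v` as a finset: `{j : v_j ≠ 0}`. -/
def suppF {n m : ℕ} (v : Fin n → ZMod m) : Finset (Fin n) :=
  Finset.univ.filter fun j => v j ≠ 0

/-- The matrix `E_S = ⊗_{j} E_{1[j∈S]}` on `ℂ^D`, where `E_0 = J_m/m` (all entries `1/m`)
and `E_1 = I_m - E_0` (entries `δ_{ab} - 1/m`). -/
def ES {n : ℕ} (m : ℕ) [NeZero m] (S : Finset (Fin n)) :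
    Matrix (Fin n → ZMod m) (Fin n → ZMod m) ℂ :=
  Matrix.of fun x y => ∏ j,
    if j ∈ S then ((if x j = y j then (1 : ℂ) else 0) - 1 / m) else (1 / m : ℂ)

/-- The coefficients `α_ℓ = (n choose k)^{-1/2} max{n^{k/(k+1)} - ℓ, 0}`. -/
def alpha (n k : ℕ) (ℓ : ℕ) : ℝ :=
  ((n.choose k : ℝ) ^ (-(1 / 2 : ℝ))) * max ((n : ℝ) ^ ((k : ℝ) / ((k : ℝ) + 1)) - ℓ) 0

/-- The set `P_V = {x ∈ D : ∑_{t∈V} x_t = w}`, as a subtype of `D`. -/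
def PV {n : ℕ} (m : ℕ) [NeZero m] (w : ZMod m) (V : Finset (Fin n)) : Type :=
  {x : Fin n → ZMod m // ∑ t ∈ V, x t = w}

instance {n m : ℕ} [NeZero m] (w : ZMod m) (V : Finset (Fin n)) : Fintype (PV m w V) :=
  Subtype.fintype _

instance {n m : ℕ} [NeZero m] (w : ZMod m) (V : Finset (Fin n)) : DecidableEq (PV m w V) :=
  Subtype.instDecidableEq

/-- The `P_V × D` matrix `G_V = √m ∑_{S : V ⊄ S} α_{|S|} E_S^{P_V,D}`, where
`E_S^{P_V,D}` is the restriction of `E_S` to rows indexed by `P_V`. -/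
def GV (n k m : ℕ) [NeZero m] (w : ZMod m) (V : Finset (Fin n)) :
    Matrix (PV m w V) (Fin n → ZMod m) ℂ :=
  Matrix.of fun x y =>
    (Real.sqrt m : ℂ) * ∑ S ∈ Finset.univ.filter (fun S : Finset (Fin n) => ¬ V ⊆ S),
      (alpha n k S.card : ℂ) * ES m S x.val y

/-- Row index type of the stacked adversary matrix `Γ`: pairs `(V, x)` where `V` is a
`k`-subset of `{1,…,n}` and `x ∈ P_V`. -/
def RowIdx (n k m : ℕ) [NeZero m] (w : ZMod m) : Type :=
  Σ V : {V : Finset (Fin n) // V.card = k}, PV m w V.val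

instance {n k m : ℕ} [NeZero m] (w : ZMod m) : Fintype (RowIdx n k m w) :=
  Sigma.instFintype

instance {n k m : ℕ} [NeZero m] (w : ZMod m) : DecidableEq (RowIdx n k m w) :=
  Sigma.instDecidableEqSigma

/-- The stacked adversary matrix `Γ` for `k`-SUM: `Γ[(V,x), y] = G_V[x, y]`. -/
def Gamma (n k m : ℕ) [NeZero m] (w : ZMod m) :
    Matrix (RowIdx n k m w) (Fin n → ZMod m) ℂ :=
  Matrix.of fun r y => GV n k m w r.1.val r.2 y

end KSum

end

/-- The spectral norm (largest singular value) of a complex matrix. -/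
noncomputable def specNorm {α β : Type*} [Fintype α] [Fintype β] [DecidableEq β]
    (A : Matrix α β ℂ) : ℝ :=
  ‖LinearMap.toContinuousLinearMap (Matrix.toEuclideanLin A)‖

namespace KSumAux

open KSum Finset

noncomputable section

variable {n m : ℕ} [NeZero m]

/-- Pairing character. -/
def chi (m : ℕ) [NeZero m] {n : ℕ} (v x : Fin n → ZMod m) : ℂ :=
  ZMod.stdAddChar (∑ j, v j * x j)

lemma chi_comm (v x : Fin n → ZMod m) : chi m v x = chi m x v := by
  simp only [chi, mul_comm]

lemma chi_add (v v' x : Fin n → ZMod m) : chi m (v + v') x = chi m v x * chi m v' x := by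
  simp only [chi, Pi.add_apply, add_mul, sum_add_distrib, AddChar.map_add_eq_mul]

lemma chi_neg (v x : Fin n → ZMod m) : chi m (-v) x = (starRingEnd ℂ) (chi m v x) := by
  simp only [chi, Pi.neg_apply, neg_mul, sum_neg_distrib, AddChar.map_neg_eq_conj]

lemma chi_neg_right (v x : Fin n → ZMod m) : chi m v (-x) = (starRingEnd ℂ) (chi m v x) := by
  rw [chi_comm, chi_neg, chi_comm]

lemma chi_prod (v x : Fin n → ZMod m) :
    chi m v x = ∏ j, (ZMod.stdAddChar (v j * x j) : ℂ) := by
  rw [chi]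
  induction (univ : Finset (Fin n)) using Finset.induction_on with
  | empty => simp
  | insert j s hj ih => rw [sum_insert hj, prod_insert hj, AddChar.map_add_eq_mul, ih]

lemma sum_std (a : ZMod m) :
    ∑ b : ZMod m, (ZMod.stdAddChar (b * a) : ℂ) = if a = 0 then (m : ℂ) else 0 := by
  have h := AddChar.sum_mulShift a (ZMod.isPrimitive_stdAddChar m)
  rw [h]; simp [ZMod.card]

lemma sum_chi (v : Fin n → ZMod m) :
    ∑ x : Fin n → ZMod m, chi m v x = if v = 0 then (m : ℂ) ^ n else 0 := by
  have h : ∑ x : Fin n → ZMod m, chi m v x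
      = ∏ j, ∑ b : ZMod m, (ZMod.stdAddChar (b * v j) : ℂ) := by
    rw [Finset.prod_univ_sum, Fintype.piFinset_univ]
    refine sum_congr rfl fun x _ => ?_
    rw [chi_comm, chi_prod]
  rw [h]
  simp only [sum_std]
  split_ifs with h0
  · subst h0; simp
  · obtain ⟨j, hj⟩ : ∃ j, v j ≠ 0 := by
      by_contra! hc; exact h0 (funext hc)
    exact prod_eq_zero (mem_univ j) (by simp [hj])

/-- Unnormalised Fourier transform. -/
def FT (f : (Fin n → ZMod m) → ℂ) (x : Fin n → ZMod m) : ℂ := ∑ v, f v * chi m v x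

lemma FT_pair (f : (Fin n → ZMod m) → ℂ) (s : Fin n → ZMod m) :
    ∑ x, chi m s x * (FT f x * (starRingEnd ℂ) (FT f x))
      = (m : ℂ) ^ n * ∑ v, f v * (starRingEnd ℂ) (f (v + s)) := by
  have h : ∀ x, chi m s x * (FT f x * (starRingEnd ℂ) (FT f x))
      = ∑ v, ∑ v', f v * (starRingEnd ℂ) (f v') * chi m (v + s - v') x := by
    intro x
    simp only [FT, map_sum]
    rw [sum_mul_sum]
    simp only [mul_sum]
    refine sum_congr rfl fun v _ => sum_congr rfl fun v' _ => ?_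
    rw [sub_eq_add_neg, chi_add, chi_add, chi_neg, map_mul]; ring
  simp only [h]
  rw [sum_comm, mul_sum]
  refine sum_congr rfl fun v _ => ?_
  rw [sum_comm]
  simp only [← mul_sum, sum_chi, sub_eq_zero]
  simp; ring

lemma parseval (f : (Fin n → ZMod m) → ℂ) :
    ∑ x, ‖FT f x‖ ^ 2 = (m : ℝ) ^ n * ∑ v, ‖f v‖ ^ 2 := by
  have h := FT_pair f 0
  have h0 : ∀ x, chi m (0 : Fin n → ZMod m) x = 1 := by intro x; simp [chi]
  simp only [h0, one_mul, add_zero, Complex.mul_conj, Complex.normSq_eq_norm_sq] at h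
  exact_mod_cast h

lemma ES_eq (S : Finset (Fin n)) (x y : Fin n → ZMod m) :
    ES m S x y = ((m : ℂ) ^ n)⁻¹ * ∑ v ∈ univ.filter (fun v => suppF v = S), chi m v (x - y) := by
  have hset : (univ.filter (fun v : Fin n → ZMod m => suppF v = S))
      = Fintype.piFinset (fun j => if j ∈ S then (univ.filter fun a : ZMod m => a ≠ 0) else {0}) := by
    ext v
    simp only [mem_filter, mem_univ, true_and, Fintype.mem_piFinset, suppF, Finset.ext_iff]
    refine forall_congr' fun j => ?_
    by_cases hj : j ∈ S <;> simp [hj]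
  rw [hset]
  simp only [chi_prod]
  rw [← Finset.prod_univ_sum (fun j => if j ∈ S then (univ.filter fun a : ZMod m => a ≠ 0) else {0})
    (fun j a => (ZMod.stdAddChar (a * (x - y) j) : ℂ))]
  have hm : (m : ℂ) ≠ 0 := NeZero.ne _
  have : ((m : ℂ) ^ n)⁻¹ = ∏ _j : Fin n, (m : ℂ)⁻¹ := by simp
  rw [this, ← prod_mul_distrib]
  simp only [ES, Matrix.of_apply]
  refine prod_congr rfl fun j _ => ?_
  split_ifs with hj hxy
  · have := sum_std (x j - y j)
    rw [← Finset.sum_filter_add_sum_filter_not univ (fun a : ZMod m => a ≠ 0)] at this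
    simp [hxy, Finset.filter_eq', sub_eq_zero] at this ⊢
    rw [eq_sub_of_add_eq this]; field_simp
  · have := sum_std (x j - y j)
    rw [← Finset.sum_filter_add_sum_filter_not univ (fun a : ZMod m => a ≠ 0)] at this
    simp [hxy, Finset.filter_eq', sub_eq_zero] at this ⊢
    rw [eq_neg_of_add_eq_zero_left this]; ring
  · simp

/-- Fourier-side coefficients of `G_V u`. -/
def bV (n k : ℕ) (V : Finset (Fin n)) (u : (Fin n → ZMod m) → ℂ) (v : Fin n → ZMod m) : ℂ :=
  if V ⊆ suppF v then 0 else (alpha n k (suppF v).card : ℂ) * FT u (-v)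

lemma GV_eq (k : ℕ) (w : ZMod m) (V : Finset (Fin n)) (u : (Fin n → ZMod m) → ℂ) (x : PV m w V) :
    ∑ y, GV n k m w V x y * u y
      = (Real.sqrt m : ℂ) * ((m : ℂ) ^ n)⁻¹ * FT (bV n k V u) x.val := by
  have h1 : ∀ y, GV n k m w V x y = (Real.sqrt m : ℂ) * ((m : ℂ) ^ n)⁻¹ *
      ∑ v, if V ⊆ suppF v then 0 else
        (alpha n k (suppF v).card : ℂ) * (chi m v x.val * chi m v (-y)) := by
    intro y
    simp only [GV, Matrix.of_apply, ES_eq, mul_assoc]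
    congr 1
    rw [mul_sum, ← Finset.sum_fiberwise univ (fun v : Fin n → ZMod m => suppF v), sum_filter]
    refine sum_congr rfl fun S _ => ?_
    by_cases hS : V ⊆ S
    · simp only [hS, not_true, if_false]
      symm
      refine sum_eq_zero fun v hv => ?_
      rw [(mem_filter.mp hv).2]; simp [hS]
    · simp only [hS, not_false_iff, if_true]
      rw [mul_left_comm, mul_sum, mul_sum]
      refine sum_congr rfl fun v hv => ?_
      rw [(mem_filter.mp hv).2]
      simp only [hS, if_false]
      congr 2
      rw [sub_eq_add_neg, chi_comm, chi_add, chi_comm, chi_comm (-y)]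
  simp only [h1, mul_assoc, ← mul_sum]
  congr 2
  simp only [sum_mul, FT, bV]
  rw [sum_comm]
  refine sum_congr rfl fun v _ => ?_
  split_ifs
  · simp
  · rw [mul_sum, sum_mul]
    refine sum_congr rfl fun y _ => ?_
    rw [chi_neg_right, ← chi_neg, chi_comm (-v)]; ring

/-- The vector `a · 1_V`. -/
def sh (V : Finset (Fin n)) (a : ZMod m) : Fin n → ZMod m := fun j => if j ∈ V then a else 0

lemma chi_sh (V : Finset (Fin n)) (a : ZMod m) (x : Fin n → ZMod m) :
    chi m (sh V a) x = ZMod.stdAddChar (a * ∑ t ∈ V, x t) := by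
  simp [chi, sh, mul_sum]

lemma sh_neg (V : Finset (Fin n)) (a : ZMod m) : sh V (-a) = - sh V a := by
  ext j; simp only [sh, Pi.neg_apply]; split_ifs <;> simp

lemma GV_norm (k : ℕ) (w : ZMod m) (V : Finset (Fin n)) (u : (Fin n → ZMod m) → ℂ) :
    ∑ x : PV m w V, ‖∑ y, GV n k m w V x y * u y‖ ^ 2
      ≤ ((m : ℝ) ^ n)⁻¹ * ∑ a : ZMod m, ∑ v, ‖bV n k V u v‖ * ‖bV n k V u (v + sh V a)‖ := by
  have hm : (m : ℂ) ≠ 0 := NeZero.ne _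
  have hm' : (m : ℝ) ≠ 0 := NeZero.ne _
  set b := bV n k V u with hb
  have key : (((m : ℝ) * ∑ x : PV m w V, ‖FT b x.val‖ ^ 2 : ℝ) : ℂ)
      = (m : ℂ) ^ n * ∑ a : ZMod m, (ZMod.stdAddChar (a * (-w)) : ℂ) *
        ∑ v, b v * (starRingEnd ℂ) (b (v + sh V a)) := by
    have e1 : (m : ℂ) ^ n * ∑ a : ZMod m, (ZMod.stdAddChar (a * (-w)) : ℂ) *
        ∑ v, b v * (starRingEnd ℂ) (b (v + sh V a))
        = ∑ x : Fin n → ZMod m, ∑ a : ZMod m, (ZMod.stdAddChar (a * -w) : ℂ) *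
        (ZMod.stdAddChar (a * ∑ t ∈ V, x t) * (FT b x * (starRingEnd ℂ) (FT b x))) := by
      rw [mul_sum, sum_comm]
      refine sum_congr rfl fun a _ => ?_
      rw [mul_left_comm, ← FT_pair, mul_sum]
      simp only [chi_sh]
    have : ∀ x : Fin n → ZMod m, ∑ a : ZMod m, (ZMod.stdAddChar (a * -w) : ℂ) *
        (ZMod.stdAddChar (a * ∑ t ∈ V, x t) * (FT b x * (starRingEnd ℂ) (FT b x)))
        = if ∑ t ∈ V, x t = w then (m : ℂ) * ((‖FT b x‖ ^ 2 : ℝ) : ℂ) else 0 := by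
      intro x
      simp only [← mul_assoc, ← AddChar.map_add_eq_mul, ← mul_add, ← sum_mul]
      rw [sum_std, mul_assoc, Complex.mul_conj, Complex.normSq_eq_norm_sq]
      by_cases hw : ∑ t ∈ V, x t = w
      · rw [if_pos hw, if_pos (by rw [hw]; simp)]
      · rw [if_neg hw, if_neg (fun h => hw (neg_add_eq_zero.mp h).symm), zero_mul]
    rw [e1, sum_congr rfl fun x _ => this x, ← sum_filter, Complex.ofReal_mul, Complex.ofReal_sum,
      mul_sum]
    symm
    exact sum_subtype (univ.filter fun x : Fin n → ZMod m => ∑ t ∈ V, x t = w) (by simp)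
      (fun x => (m : ℂ) * ((‖FT b x‖ ^ 2 : ℝ) : ℂ))
  have h2 : (m : ℝ) * ∑ x : PV m w V, ‖FT b x.val‖ ^ 2
      ≤ (m : ℝ) ^ n * ∑ a : ZMod m, ∑ v, ‖b v‖ * ‖b (v + sh V a)‖ := by
    have h3 : (m : ℝ) * ∑ x : PV m w V, ‖FT b x.val‖ ^ 2
      = ‖(((m : ℝ) * ∑ x : PV m w V, ‖FT b x.val‖ ^ 2 : ℝ) : ℂ)‖ := by
      rw [Complex.norm_real, Real.norm_of_nonneg]; positivity
    rw [h3, key, norm_mul]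
    simp only [norm_pow, Complex.norm_natCast]
    gcongr
    refine (norm_sum_le _ _).trans (sum_le_sum fun a _ => ?_)
    rw [norm_mul, AddChar.norm_apply, one_mul]
    refine (norm_sum_le _ _).trans (sum_le_sum fun v _ => ?_)
    rw [norm_mul, RCLike.norm_conj]
  have h4 : ∑ x : PV m w V, ‖∑ y, GV n k m w V x y * u y‖ ^ 2
      = (((m : ℝ) ^ n)⁻¹) ^ 2 * ((m : ℝ) * ∑ x : PV m w V, ‖FT b x.val‖ ^ 2) := by
    simp only [GV_eq, mul_sum]
    refine sum_congr rfl fun x _ => ?_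
    rw [norm_mul, norm_mul, Complex.norm_real, Real.norm_of_nonneg (Real.sqrt_nonneg _), mul_pow,
      mul_pow, Real.sq_sqrt (by positivity), norm_inv, norm_pow, Complex.norm_natCast]
    ring
  rw [h4]
  calc _ ≤ (((m : ℝ) ^ n)⁻¹) ^ 2 * ((m : ℝ) ^ n * ∑ a : ZMod m, ∑ v, ‖b v‖ * ‖b (v + sh V a)‖) :=
        mul_le_mul_of_nonneg_left h2 (by positivity)
    _ = _ := by field_simp

lemma sum_shift (V : Finset (Fin n)) (k : ℕ) (u : (Fin n → ZMod m) → ℂ) :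
    ∑ a : ZMod m, ∑ v, ‖bV n k V u v‖ * ‖bV n k V u (v + sh V a)‖
      ≤ ∑ v, ‖bV n k V u v‖ ^ 2 * (1 + (V ∩ suppF v).card : ℝ) := by
  set b := bV n k V u with hb
  let I : (Fin n → ZMod m) → ℝ := fun v => if V ⊆ suppF v then 0 else 1
  have h1 : ∀ a v, ‖b v‖ * ‖b (v + sh V a)‖
      ≤ (‖b v‖ ^ 2 * I (v + sh V a)) / 2 + (‖b (v + sh V a)‖ ^ 2 * I v) / 2 := by
    intro a v
    by_cases hv : V ⊆ suppF v
    · have : b v = 0 := by simp [hb, bV, hv]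
      simp [this, I, hv]
    · by_cases hv' : V ⊆ suppF (v + sh V a)
      · have : b (v + sh V a) = 0 := by simp [hb, bV, hv']
        simp [this, I, hv']
      · simp only [I, hv, hv', if_false]
        nlinarith [sq_nonneg (‖b v‖ - ‖b (v + sh V a)‖)]
  have h2 : ∑ a : ZMod m, ∑ v, ‖b (v + sh V a)‖ ^ 2 * I v
      = ∑ a : ZMod m, ∑ v, ‖b v‖ ^ 2 * I (v + sh V a) := by
    rw [← Equiv.sum_comp (Equiv.neg (ZMod m))]
    refine sum_congr rfl fun a _ => ?_
    rw [← Equiv.sum_comp (Equiv.addRight (sh V a))]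
    refine sum_congr rfl fun v _ => ?_
    simp [sh_neg]
  have h3 : ∀ v, ∑ a : ZMod m, I (v + sh V a) ≤ 1 + (V ∩ suppF v).card := by
    intro v
    have e : ∑ a : ZMod m, I (v + sh V a)
        = ((univ.filter fun a : ZMod m => ¬ V ⊆ suppF (v + sh V a)).card : ℝ) := by
      rw [card_filter]; push_cast
      refine sum_congr rfl fun a _ => ?_
      by_cases h : V ⊆ suppF (v + sh V a) <;> simp [I, h]
    rw [e]
    have hs : (univ.filter fun a : ZMod m => ¬ V ⊆ suppF (v + sh V a))
        ⊆ insert 0 ((V ∩ suppF v).image fun j => - v j) := by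
      intro a ha
      obtain ⟨j, hj, hj'⟩ := not_subset.mp (mem_filter.mp ha).2
      replace hj' : v j + a = 0 := by
        by_contra hc
        exact hj' (mem_filter.mpr ⟨mem_univ _, by simpa [sh, hj] using hc⟩)
      by_cases h0 : v j = 0
      · rw [h0, zero_add] at hj'; simp [hj']
      · refine mem_insert_of_mem (mem_image.mpr ⟨j, ?_, ?_⟩)
        · simp [suppF, hj, h0]
        · exact (eq_neg_of_add_eq_zero_right hj').symm
    have := (card_le_card hs).trans ((card_insert_le _ _).trans
      (Nat.add_le_add_right card_image_le 1))
    rw [add_comm]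
    exact_mod_cast this
  calc _ ≤ ∑ a : ZMod m, ∑ v, ((‖b v‖ ^ 2 * I (v + sh V a)) / 2
            + (‖b (v + sh V a)‖ ^ 2 * I v) / 2) :=
        sum_le_sum fun a _ => sum_le_sum fun v _ => h1 a v
    _ = ∑ a : ZMod m, ∑ v, ‖b v‖ ^ 2 * I (v + sh V a) := by
        simp only [sum_add_distrib, ← sum_div]
        rw [h2]; ring
    _ = ∑ v, ‖b v‖ ^ 2 * ∑ a : ZMod m, I (v + sh V a) := by
        rw [sum_comm]; simp only [mul_sum]
    _ ≤ _ := sum_le_sum fun v _ => mul_le_mul_of_nonneg_left (h3 v) (by positivity)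

lemma card_mem (k : ℕ) (j : Fin n) :
    ((univ : Finset {V : Finset (Fin n) // V.card = k}).filter fun V => j ∈ V.val).card
      ≤ (n - 1).choose (k - 1) := by
  have : (powersetCard (k - 1) ((univ : Finset (Fin n)).erase j)).card
      = (n - 1).choose (k - 1) := by
    rw [card_powersetCard, card_erase_of_mem (mem_univ j), card_univ, Fintype.card_fin]
  rw [← this]
  refine card_le_card_of_injOn (fun V => V.val.erase j) ?_ ?_
  · intro V hV
    have hV := (mem_filter.mp hV).2
    simp only [mem_coe, mem_powersetCard]
    exact ⟨erase_subset_erase _ (subset_univ _), by rw [card_erase_of_mem hV, V.2]⟩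
  · intro V hV W hW h
    have hV := (mem_filter.mp hV).2
    have hW := (mem_filter.mp hW).2
    apply Subtype.ext
    rw [← insert_erase hV, ← insert_erase hW]
    exact congrArg (insert j) h

lemma sum_inter (k : ℕ) (hk : 1 ≤ k) (hn : k < n) (S : Finset (Fin n)) :
    ∑ V : {V : Finset (Fin n) // V.card = k}, (1 + (V.val ∩ S).card : ℝ)
      ≤ (n.choose k : ℝ) * (1 + k * S.card / n) := by
  have hc : Fintype.card {V : Finset (Fin n) // V.card = k} = n.choose k := by
    simp
  have h1 : ∑ V : {V : Finset (Fin n) // V.card = k}, (V.val ∩ S).card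
      ≤ S.card * (n - 1).choose (k - 1) := by
    have : ∀ V : {V : Finset (Fin n) // V.card = k},
        (V.val ∩ S).card = ∑ j ∈ S, if j ∈ V.val then 1 else 0 := by
      intro V
      rw [← card_filter, inter_comm, filter_mem_eq_inter]
    simp only [this]
    rw [sum_comm, ← smul_eq_mul]
    refine sum_le_card_nsmul _ _ _ fun j _ => ?_
    rw [← card_filter]
    exact card_mem k j
  have h2 : n * (n - 1).choose (k - 1) = n.choose k * k := by
    obtain ⟨n', rfl⟩ : ∃ n', n = n' + 1 := ⟨n - 1, by omega⟩
    obtain ⟨k', rfl⟩ : ∃ k', k = k' + 1 := ⟨k - 1, by omega⟩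
    exact Nat.add_one_mul_choose_eq n' k'
  have hn0 : (0 : ℝ) < n := by exact_mod_cast (by omega : 0 < n)
  have h2' : ((n - 1).choose (k - 1) : ℝ) = (n.choose k : ℝ) * k / n := by
    rw [eq_div_iff hn0.ne', mul_comm]; exact_mod_cast h2
  have h1' : ∑ V : {V : Finset (Fin n) // V.card = k}, ((V.val ∩ S).card : ℝ)
      ≤ S.card * ((n - 1).choose (k - 1) : ℝ) := by exact_mod_cast h1
  rw [sum_add_distrib, sum_const, card_univ, hc, nsmul_eq_mul, mul_one]
  rw [h2'] at h1'
  refine (add_le_add_right h1' _).trans (le_of_eq ?_)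
  ring

lemma alpha_bound (k : ℕ) (hn : k < n) (t : ℕ) :
    alpha n k t ^ 2 * ((n.choose k : ℝ) * (1 + k * t / n))
      ≤ ((n : ℝ) ^ ((k : ℝ) / ((k : ℝ) + 1))) ^ 2 *
        (1 + k * (n : ℝ) ^ ((k : ℝ) / ((k : ℝ) + 1)) / n) := by
  set N := (n : ℝ) ^ ((k : ℝ) / ((k : ℝ) + 1)) with hN
  have hN0 : 0 ≤ N := by positivity
  have hC : (0 : ℝ) < n.choose k := by exact_mod_cast Nat.choose_pos hn.le
  have hC2 : ((n.choose k : ℝ) ^ (-(1 / 2 : ℝ))) ^ 2 * n.choose k = 1 := by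
    rw [← Real.rpow_natCast, ← Real.rpow_mul hC.le]
    norm_num
    rw [Real.rpow_neg_one, inv_mul_cancel₀ hC.ne']
  have e : alpha n k t ^ 2 * ((n.choose k : ℝ) * (1 + k * t / n))
      = (max (N - t) 0) ^ 2 * (1 + k * t / n) := by
    rw [alpha, mul_pow]
    linear_combination (max (N - t) 0) ^ 2 * (1 + k * t / n) * hC2
  rw [e]
  rcases le_total N t with h | h
  · rw [max_eq_right (by linarith)]
    rw [zero_pow two_ne_zero, zero_mul]; positivity
  · rw [max_eq_left (by linarith)]
    have : (0 : ℝ) ≤ t := by positivity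
    gcongr
    linarith

lemma Gamma_bound (k : ℕ) (hk : 1 ≤ k) (w : ZMod m) (hn : k < n)
    (u : (Fin n → ZMod m) → ℂ) :
    ∑ r, ‖∑ y, Gamma n k m w r y * u y‖ ^ 2
      ≤ ((n : ℝ) ^ ((k : ℝ) / ((k : ℝ) + 1))) ^ 2 *
        (1 + k * (n : ℝ) ^ ((k : ℝ) / ((k : ℝ) + 1)) / n) * ∑ y, ‖u y‖ ^ 2 := by
  set B := ((n : ℝ) ^ ((k : ℝ) / ((k : ℝ) + 1))) ^ 2 *
        (1 + k * (n : ℝ) ^ ((k : ℝ) / ((k : ℝ) + 1)) / n) with hB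
  have hm' : (m : ℝ) ≠ 0 := NeZero.ne _
  have h0 : ∑ r, ‖∑ y, Gamma n k m w r y * u y‖ ^ 2
      = ∑ V : {V : Finset (Fin n) // V.card = k}, ∑ x : PV m w V.val,
          ‖∑ y, GV n k m w V.val x y * u y‖ ^ 2 :=
    Fintype.sum_sigma (fun r : (Σ V : {V : Finset (Fin n) // V.card = k}, PV m w V.val) =>
      ‖∑ y, GV n k m w r.1.val r.2 y * u y‖ ^ 2)
  rw [h0]
  have hp : ∑ v, ‖FT u (-v)‖ ^ 2 = (m : ℝ) ^ n * ∑ v, ‖u v‖ ^ 2 := by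
    rw [← parseval, ← Equiv.sum_comp (Equiv.neg (Fin n → ZMod m)) (fun x => ‖FT u x‖ ^ 2)]
    rfl
  calc _ ≤ ∑ V : {V : Finset (Fin n) // V.card = k}, ((m : ℝ) ^ n)⁻¹ *
          ∑ v, (alpha n k (suppF v).card ^ 2 * ‖FT u (-v)‖ ^ 2) *
            (1 + (V.val ∩ suppF v).card : ℝ) := by
        refine sum_le_sum fun V _ => (GV_norm k w V.val u).trans ?_
        refine mul_le_mul_of_nonneg_left ((sum_shift V.val k u).trans ?_) (by positivity)
        refine sum_le_sum fun v _ => mul_le_mul_of_nonneg_right ?_ (by positivity)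
        unfold bV
        split_ifs
        · rw [norm_zero, zero_pow two_ne_zero]; positivity
        · rw [norm_mul, Complex.norm_real, mul_pow, Real.norm_eq_abs, sq_abs]
    _ = ((m : ℝ) ^ n)⁻¹ * ∑ v, ‖FT u (-v)‖ ^ 2 * (alpha n k (suppF v).card ^ 2 *
          ∑ V : {V : Finset (Fin n) // V.card = k}, (1 + (V.val ∩ suppF v).card : ℝ)) := by
        rw [← mul_sum, sum_comm]
        congr 1
        refine sum_congr rfl fun v _ => ?_
        rw [← mul_sum]; ring
    _ ≤ ((m : ℝ) ^ n)⁻¹ * ∑ v, ‖FT u (-v)‖ ^ 2 * B := by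
        refine mul_le_mul_of_nonneg_left (sum_le_sum fun v _ => ?_) (by positivity)
        refine mul_le_mul_of_nonneg_left ?_ (by positivity)
        exact (mul_le_mul_of_nonneg_left (sum_inter k hk hn _) (by positivity)).trans
          (alpha_bound k hn _)
    _ = _ := by
        rw [← sum_mul, hp]; field_simp

lemma spec_sq (k : ℕ) (hk : 1 ≤ k) (w : ZMod m) (hn : k < n) :
    specNorm (Gamma n k m w) ^ 2
      ≤ ((n : ℝ) ^ ((k : ℝ) / ((k : ℝ) + 1))) ^ 2 *
        (1 + k * (n : ℝ) ^ ((k : ℝ) / ((k : ℝ) + 1)) / n) := by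
  have hB0 : 0 ≤ ((n : ℝ) ^ ((k : ℝ) / ((k : ℝ) + 1))) ^ 2 *
        (1 + k * (n : ℝ) ^ ((k : ℝ) / ((k : ℝ) + 1)) / n) := by positivity
  have hb : specNorm (Gamma n k m w) ≤ Real.sqrt (((n : ℝ) ^ ((k : ℝ) / ((k : ℝ) + 1))) ^ 2 *
        (1 + k * (n : ℝ) ^ ((k : ℝ) / ((k : ℝ) + 1)) / n)) := by
    refine ContinuousLinearMap.opNorm_le_bound _ (Real.sqrt_nonneg _) fun u => ?_
    rw [← Real.sqrt_sq (norm_nonneg u), ← Real.sqrt_mul hB0]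
    refine Real.le_sqrt_of_sq_le ?_
    rw [EuclideanSpace.norm_sq_eq, EuclideanSpace.norm_sq_eq]
    exact Gamma_bound k hk w hn u.ofLp
  calc _ ≤ _ := pow_le_pow_left₀ (norm_nonneg _) hb 2
    _ = _ := Real.sq_sqrt hB0

end

end KSumAux

open KSum in
/-- For `n > k`, the stacked `k`-SUM adversary matrix `Γ` satisfies
`‖Γ‖² ≤ n^{2k/(k+1)} (1 + k² n^{k/(k+1)} / (n - k + 1))`; in particular, for each fixed
`k` there is a constant `C` with `‖Γ‖ ≤ (1 + C n^{-1/(k+1)}) n^{k/(k+1)}` for all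
`n > k`. -/
theorem stmt9 (k : ℕ) (hk : 1 ≤ k) :
    (∀ (n m : ℕ) [NeZero m], ∀ (w : ZMod m), k < n → 2 ≤ m →
      specNorm (Gamma n k m w) ^ 2
        ≤ (n : ℝ) ^ (2 * (k : ℝ) / ((k : ℝ) + 1)) *
            (1 + (k : ℝ) ^ 2 * (n : ℝ) ^ ((k : ℝ) / ((k : ℝ) + 1))
              / ((n : ℝ) - (k : ℝ) + 1))) ∧
    ∃ C : ℝ, ∀ (n m : ℕ) [NeZero m], ∀ (w : ZMod m), k < n → 2 ≤ m →
      specNorm (Gamma n k m w)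
        ≤ (1 + C * (n : ℝ) ^ (-(1 : ℝ) / ((k : ℝ) + 1))) *
            (n : ℝ) ^ ((k : ℝ) / ((k : ℝ) + 1)) := by
  have hpow : ∀ n : ℕ, ((n : ℝ) ^ ((k : ℝ) / ((k : ℝ) + 1))) ^ 2
      = (n : ℝ) ^ (2 * (k : ℝ) / ((k : ℝ) + 1)) := by
    intro n
    rw [← Real.rpow_natCast, ← Real.rpow_mul (by positivity)]
    congr 1; push_cast; ring
  refine ⟨?_, (k : ℝ), ?_⟩
  · intro n m _ w hn _
    refine (KSumAux.spec_sq k hk w hn).trans ?_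
    rw [hpow]
    have h1 : (1 : ℝ) ≤ k := by exact_mod_cast hk
    have h2 : (k : ℝ) < n := by exact_mod_cast hn
    have h3 : (0 : ℝ) < (n : ℝ) - k + 1 := by linarith
    have h4 : (k : ℝ) ≤ (k : ℝ) ^ 2 := by nlinarith
    gcongr
    linarith
  · intro n m _ w hn _
    have h := KSumAux.spec_sq k hk w hn
    have hn0 : (0 : ℝ) < n := by exact_mod_cast (by omega : 0 < n)
    have e : (n : ℝ) ^ (-(1 : ℝ) / ((k : ℝ) + 1))
        = (n : ℝ) ^ ((k : ℝ) / ((k : ℝ) + 1)) / n := by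
      rw [← Real.rpow_sub_one hn0.ne']
      congr 1
      field_simp
      ring
    rw [e]
    refine le_of_sq_le_sq (h.trans ?_) (by positivity)
    set N := (n : ℝ) ^ ((k : ℝ) / ((k : ℝ) + 1))
    have hx : 0 ≤ (k : ℝ) * (N / n) := by positivity
    rw [mul_div_assoc, mul_pow, mul_comm]
    gcongr
    nlinarith
end

section
/- For each fixed $k\ge 1$ there exists a constant $C$ (depending only on $k$) such that for all $n\ge k$, all $m\ge 2$, all $w\in\mathbb{Z}/m\mathbb{Z}$, and all $j\in\{1,\dots,n\}$, the stacked $k$-SUM adversary matrix $\Gamma$ satisfies $\|\Gamma\circ\Delta_j\| \le C$, where $\Delta_j$ is the $\{(V,x)\}\times D$ matrix with $\Delta_j[(V,x),y]=1$ if $x_j\neq y_j$ and $0$ otherwise. -/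
namespace KSum

open Matrix Finset

/-- squared l2 norm -/
noncomputable def nsq {α : Type*} [Fintype α] (f : α → ℂ) : ℝ := ∑ x, ‖f x‖ ^ 2

lemma nsq_eq {α : Type*} [Fintype α] (f : α → ℂ) : (nsq f : ℂ) = star f ⬝ᵥ f := by
  unfold nsq dotProduct
  push_cast
  refine Finset.sum_congr rfl fun x _ => ?_
  simp [Complex.conj_mul']

/-- single coordinate factor -/
noncomputable def fac (m : ℕ) (b : Prop) [Decidable b] (a c : ZMod m) : ℂ :=
  if b then ((if a = c then (1 : ℂ) else 0) - 1 / m) else (1 / m : ℂ)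

lemma ES_apply {n m : ℕ} [NeZero m] (S : Finset (Fin n)) (x y : Fin n → ZMod m) :
    ES m S x y = ∏ j, fac m (j ∈ S) (x j) (y j) := rfl

lemma fac_mul (m : ℕ) [NeZero m] (b b' : Prop) [Decidable b] [Decidable b'] (a c : ZMod m) :
    ∑ z, fac m b a z * fac m b' z c = if (b ↔ b') then fac m b a c else 0 := by
  have hm : (m : ℂ) ≠ 0 := by exact_mod_cast NeZero.ne m
  by_cases h : b <;> by_cases h' : b' <;>
    simp [fac, h, h', sub_mul, mul_sub, Finset.sum_sub_distrib, ZMod.card, hm]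

lemma ES_mul {n m : ℕ} [NeZero m] (S T : Finset (Fin n)) :
    ES m S * ES m T = if S = T then ES m S else 0 := by
  ext x y
  rw [Matrix.mul_apply]
  simp_rw [ES_apply, ← Finset.prod_mul_distrib]
  have := Finset.prod_univ_sum (fun _ : Fin n => (Finset.univ : Finset (ZMod m)))
    (fun j z => fac m (j ∈ S) (x j) z * fac m (j ∈ T) z (y j))
  rw [Fintype.piFinset_univ] at this
  rw [← this]
  simp_rw [fac_mul]
  by_cases h : S = T
  · subst h
    simp [ES_apply]
  · rw [if_neg h]
    have : ∃ j, ¬ (j ∈ S ↔ j ∈ T) := by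
      by_contra hc
      push Not at hc
      exact h (Finset.ext hc)
    obtain ⟨j, hj⟩ := this
    exact Finset.prod_eq_zero (Finset.mem_univ j) (by rw [if_neg hj])

lemma ES_herm {n m : ℕ} [NeZero m] (S : Finset (Fin n)) : (ES m S)ᴴ = ES m S := by
  ext x y
  rw [Matrix.conjTranspose_apply, ES_apply, ES_apply, star_prod]
  refine Finset.prod_congr rfl fun j _ => ?_
  unfold fac
  split_ifs <;> simp_all

lemma ES_sum {n m : ℕ} [NeZero m] : ∑ S, ES (n := n) m S = 1 := by
  ext x y
  rw [Matrix.sum_apply]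
  have := Fintype.prod_add (fun j => ((if x j = y j then (1 : ℂ) else 0) - 1 / m))
    (fun _ => (1 / m : ℂ))
  simp only [sub_add_cancel] at this
  rw [Matrix.one_apply]
  trans ∏ i, (if x i = y i then (1 : ℂ) else 0)
  · rw [this]
    refine Finset.sum_congr rfl fun S _ => ?_
    rw [ES_apply]
    unfold fac
    rw [Finset.prod_ite]
    congr 1 <;> refine Finset.prod_congr ?_ fun _ _ => rfl
    · ext; simp
    · ext; simp
  · by_cases h : x = y
    · simp [h]
    · rw [if_neg h]
      obtain ⟨j, hj⟩ := Function.ne_iff.1 h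
      exact Finset.prod_eq_zero (Finset.mem_univ j) (by rw [if_neg hj])

lemma nsq_mulVec {α β : Type*} [Fintype α] [Fintype β] (M : Matrix α β ℂ) (f : β → ℂ) :
    (nsq (M *ᵥ f) : ℂ) = star f ⬝ᵥ ((Mᴴ * M) *ᵥ f) := by
  rw [nsq_eq, star_mulVec, ← Matrix.dotProduct_mulVec, Matrix.mulVec_mulVec]

lemma nsq_comb {n m : ℕ} [NeZero m] (A : Finset (Finset (Fin n))) (c : Finset (Fin n) → ℝ)
    (f : (Fin n → ZMod m) → ℂ) :
    nsq ((∑ S ∈ A, (c S : ℂ) • ES m S) *ᵥ f) = ∑ S ∈ A, c S ^ 2 * nsq (ES m S *ᵥ f) := by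
  have : ((nsq ((∑ S ∈ A, (c S : ℂ) • ES m S) *ᵥ f) : ℝ) : ℂ)
      = ((∑ S ∈ A, c S ^ 2 * nsq (ES m S *ᵥ f) : ℝ) : ℂ) := by
    push_cast
    simp_rw [nsq_mulVec, ES_herm, ES_mul]
    have : (∑ S ∈ A, (c S : ℂ) • ES m S)ᴴ * (∑ S ∈ A, (c S : ℂ) • ES m S)
        = ∑ S ∈ A, ((c S : ℂ) ^ 2) • ES m S := by
      rw [Matrix.conjTranspose_sum, Finset.sum_mul]
      refine Finset.sum_congr rfl fun S hS => ?_
      rw [Finset.mul_sum, Finset.sum_eq_single S]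
      · rw [Matrix.conjTranspose_smul, ES_herm, Matrix.smul_mul, Matrix.mul_smul, ES_mul, smul_smul]
        simp [pow_two]
      · intro T _ hT
        simp [ES_herm, ES_mul, Ne.symm hT]
      · simp [hS]
    rw [this, Matrix.sum_mulVec, dotProduct_sum]
    simp [Matrix.smul_mulVec]
  exact_mod_cast this

lemma nsq_total {n m : ℕ} [NeZero m] (f : (Fin n → ZMod m) → ℂ) :
    ∑ S, nsq (ES m S *ᵥ f) = nsq f := by
  have := nsq_comb (n := n) (m := m) Finset.univ (fun _ => 1) f
  simp only [Complex.ofReal_one, one_smul, ES_sum, Matrix.one_mulVec, one_pow, one_mul] at this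
  exact this.symm

lemma ES_shift {n m : ℕ} [NeZero m] (S : Finset (Fin n)) (t : Fin n) (ht : t ∉ S)
    (x y : Fin n → ZMod m) (a : ZMod m) : ES m S (x + Pi.single t a) y = ES m S x y := by
  rw [ES_apply, ES_apply]
  refine Finset.prod_congr rfl fun j _ => ?_
  by_cases h : j = t
  · subst h; simp [fac, ht]
  · simp [h]

lemma sum_PV {n m : ℕ} [NeZero m] (w : ZMod m) (V : Finset (Fin n)) (t : Fin n) (ht : t ∈ V)
    (g : (Fin n → ZMod m) → ℝ) (hg : ∀ x a, g (x + Pi.single t a) = g x) :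
    (m : ℝ) * ∑ x : PV m w V, g x.val = ∑ x, g x := by
  have key : ∀ a : ZMod m, ∑ x with ∑ s ∈ V, x s = a, g x = ∑ x with ∑ s ∈ V, x s = w, g x := by
    intro a
    have hs : ∀ (x : Fin n → ZMod m) (b : ZMod m),
        ∑ s ∈ V, (x + Pi.single t b : Fin n → ZMod m) s = ∑ s ∈ V, x s + b := by
      intro x b
      simp [Finset.sum_add_distrib, Finset.sum_pi_single', ht]
    refine Finset.sum_bij' (fun x _ => x + Pi.single t (w - a)) (fun x _ => x + Pi.single t (a - w))
      ?_ ?_ ?_ ?_ ?_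
    · intro x hx
      simp only [mem_filter, mem_univ, true_and] at hx ⊢
      rw [hs, hx]; ring
    · intro x hx
      simp only [mem_filter, mem_univ, true_and] at hx ⊢
      rw [hs, hx]; ring
    · intro x _
      rw [add_assoc, ← Pi.single_add]; simp
    · intro x _
      rw [add_assoc, ← Pi.single_add]; simp
    · intro x _
      rw [hg]
  rw [← Finset.sum_fiberwise Finset.univ (fun x : Fin n → ZMod m => ∑ s ∈ V, x s) g]
  simp_rw [key]
  have : ∑ x : PV m w V, g x.val = ∑ x with ∑ s ∈ V, x s = w, g x :=
    (Finset.sum_subtype _ (by simp) _).symm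
  rw [this]
  simp [ZMod.card]

lemma nsq_PV {n m : ℕ} [NeZero m] (w : ZMod m) (V : Finset (Fin n))
    (c : Finset (Fin n) → ℝ) (hc : ∀ S, V ⊆ S → c S = 0) (f : (Fin n → ZMod m) → ℂ) :
    (m : ℝ) * ∑ x : PV m w V, ‖((∑ S, (c S : ℂ) • ES m S) *ᵥ f) x.val‖ ^ 2
      ≤ V.card * ∑ S, c S ^ 2 * nsq (ES m S *ᵥ f) := by
  classical
  rcases V.eq_empty_or_nonempty with rfl | ⟨t0, ht0⟩
  · simp [hc]
  have hex : ∀ S : Finset (Fin n), ∃ t ∈ V, ¬ V ⊆ S → t ∉ S := by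
    intro S
    by_cases h : V ⊆ S
    · exact ⟨t0, ht0, fun h' => absurd h h'⟩
    · obtain ⟨t, h1, h2⟩ := Finset.not_subset.1 h
      exact ⟨t, h1, fun _ => h2⟩
  choose τ hτV hτ using hex
  let h : Fin n → (Fin n → ZMod m) → ℂ := fun t =>
    (∑ S with τ S = t, (c S : ℂ) • ES m S) *ᵥ f
  have hsum : (∑ S, (c S : ℂ) • ES m S) *ᵥ f = ∑ t ∈ V, h t := by
    rw [← Matrix.sum_mulVec]
    congr 1
    exact (Finset.sum_fiberwise_of_maps_to (fun S _ => hτV S) _).symm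
  have hinv : ∀ t x a, h t (x + Pi.single t a) = h t x := by
    intro t x a
    simp only [h, Matrix.mulVec, dotProduct]
    refine Finset.sum_congr rfl fun y _ => ?_
    congr 1
    simp only [Matrix.sum_apply, Matrix.smul_apply]
    refine Finset.sum_congr rfl fun S hS => ?_
    simp only [mem_filter, mem_univ, true_and] at hS
    by_cases hV : V ⊆ S
    · simp [hc S hV]
    · rw [ES_shift S t (hS ▸ hτ S hV)]
  have h1 : ∀ t ∈ V, (m : ℝ) * ∑ x : PV m w V, ‖h t x.val‖ ^ 2
      = ∑ S with τ S = t, c S ^ 2 * nsq (ES m S *ᵥ f) := by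
    intro t ht
    rw [sum_PV w V t ht (fun x => ‖h t x‖ ^ 2) (fun x a => by simp only [hinv])]
    exact nsq_comb _ c f
  have h2 : ∀ x, ‖(∑ t ∈ V, h t) x‖ ^ 2 ≤ V.card * ∑ t ∈ V, ‖h t x‖ ^ 2 := by
    intro x
    rw [Finset.sum_apply]
    calc _ ≤ (∑ t ∈ V, ‖h t x‖) ^ 2 := by gcongr; exact norm_sum_le _ _
      _ ≤ _ := sq_sum_le_card_mul_sum_sq
  rw [hsum]
  calc _ ≤ (m : ℝ) * ∑ x : PV m w V, V.card * ∑ t ∈ V, ‖h t x.val‖ ^ 2 := by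
        gcongr with x; exact h2 _
    _ = V.card * ∑ t ∈ V, (m : ℝ) * ∑ x : PV m w V, ‖h t x.val‖ ^ 2 := by
        rw [← Finset.mul_sum, ← Finset.mul_sum, Finset.sum_comm]; ring
    _ = V.card * ∑ S, c S ^ 2 * nsq (ES m S *ᵥ f) := by
        rw [Finset.sum_congr rfl h1, Finset.sum_fiberwise_of_maps_to (fun S _ => hτV S)]

/-- coefficients after eliminating coordinate `j` -/
noncomputable def coef (n k : ℕ) (j : Fin n) (V S : Finset (Fin n)) : ℝ :=
  if j ∈ S then 0 else (if V ⊆ S then 0 else alpha n k S.card)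
    - (if V ⊆ insert j S then 0 else alpha n k (S.card + 1))

lemma coef_zero (n k : ℕ) (j : Fin n) (V S : Finset (Fin n)) (h : V ⊆ S) :
    coef n k j V S = 0 := by
  unfold coef
  have : V ⊆ insert j S := h.trans (Finset.subset_insert _ _)
  simp [h, this]

lemma ES_insert {n m : ℕ} [NeZero m] (S : Finset (Fin n)) (j : Fin n) (hj : j ∉ S)
    (x y : Fin n → ZMod m) (h : x j ≠ y j) : ES m (insert j S) x y = - ES m S x y := by
  rw [ES_apply, ES_apply, ← Finset.mul_prod_erase _ _ (Finset.mem_univ j),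
    ← Finset.mul_prod_erase _ (fun i => fac m (i ∈ S) (x i) (y i)) (Finset.mem_univ j), ← neg_mul]
  congr 1
  · simp [fac, hj, h]
  · refine Finset.prod_congr rfl fun i hi => ?_
    have : i ≠ j := Finset.ne_of_mem_erase hi
    simp [fac, this]

lemma sum_coef {n m : ℕ} [NeZero m] (k : ℕ) (V : Finset (Fin n)) (j : Fin n)
    (x y : Fin n → ZMod m) (h : x j ≠ y j) :
    ∑ S ∈ Finset.univ.filter (fun S : Finset (Fin n) => ¬ V ⊆ S),
      (alpha n k S.card : ℂ) * ES m S x y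
    = ∑ S, (coef n k j V S : ℂ) * ES m S x y := by
  have huniv : (Finset.univ : Finset (Finset (Fin n)))
      = (insert j (Finset.univ.erase j)).powerset := by
    rw [Finset.insert_erase (Finset.mem_univ j), Finset.powerset_univ]
  rw [Finset.sum_filter, huniv, Finset.sum_powerset_insert (by simp),
    Finset.sum_powerset_insert (by simp), ← Finset.sum_add_distrib, ← Finset.sum_add_distrib]
  refine Finset.sum_congr rfl fun S hS => ?_
  have hj : j ∉ S := fun hh => by simpa using Finset.mem_powerset.1 hS hh
  rw [ES_insert S j hj x y h, Finset.card_insert_of_notMem hj]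
  simp only [coef, hj, Finset.mem_insert_self, if_true, if_false]
  split_ifs <;> push_cast <;> ring

lemma alpha_nonneg (n k l : ℕ) : 0 ≤ alpha n k l := by
  unfold alpha; positivity

lemma alpha_sq (n k l : ℕ) : alpha n k l ^ 2 =
    ((n.choose k : ℝ))⁻¹ * (max ((n : ℝ) ^ ((k : ℝ) / ((k : ℝ) + 1)) - l) 0) ^ 2 := by
  unfold alpha
  rw [mul_pow, ← Real.rpow_natCast, ← Real.rpow_mul (by positivity)]
  norm_num
  left
  exact Real.rpow_neg_one _

lemma alpha_diff (n k l : ℕ) : (alpha n k l - alpha n k (l + 1)) ^ 2 ≤ ((n.choose k : ℝ))⁻¹ := by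
  unfold alpha
  rw [← mul_sub, mul_pow, ← Real.rpow_natCast (_ ^ _), ← Real.rpow_mul (by positivity)]
  norm_num
  rw [Real.rpow_neg_one]
  apply mul_le_of_le_one_right (by positivity)
  rw [sq_le_one_iff_abs_le_one, abs_le]
  generalize (n : ℝ) ^ ((k : ℝ) / ((k : ℝ) + 1)) = X
  rcases le_total (X - l) 0 with h1 | h1 <;> rcases le_total (X - (l + 1)) 0 with h2 | h2 <;>
    simp only [max_eq_left, max_eq_right, h1, h2] <;> constructor <;> linarith

lemma pow_choose (n k : ℕ) (hk : 1 ≤ k) (hn : k ≤ n) :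
    (n : ℝ) ^ k ≤ (k : ℝ) ^ k * k.factorial * n.choose k := by
  have h1 : (n + 1 - k) ^ k ≤ n.descFactorial k := Nat.pow_sub_le_descFactorial n k
  rw [Nat.descFactorial_eq_factorial_mul_choose] at h1
  have h2 : n ≤ k * (n + 1 - k) := by
    obtain ⟨d, rfl⟩ := Nat.exists_eq_add_of_le hn
    rw [show k + d + 1 - k = d + 1 by omega]
    nlinarith
  have h3 : n ^ k ≤ k ^ k * k.factorial * n.choose k := by
    calc n ^ k ≤ (k * (n + 1 - k)) ^ k := Nat.pow_le_pow_left h2 k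
      _ = k ^ k * (n + 1 - k) ^ k := mul_pow _ _ _
      _ ≤ k ^ k * (k.factorial * n.choose k) := Nat.mul_le_mul_left _ h1
      _ = _ := by ring
  exact_mod_cast h3

lemma main_term (n k s : ℕ) (hk : 1 ≤ k) (hn : k ≤ n) :
    (s : ℝ) ^ (k - 1) * alpha n k s ^ 2 ≤ (k : ℝ) ^ k * k.factorial := by
  rw [alpha_sq]
  have hN : (0 : ℝ) < n.choose k := by exact_mod_cast Nat.choose_pos hn
  set X := (n : ℝ) ^ ((k : ℝ) / ((k : ℝ) + 1)) with hX
  have hX0 : 0 ≤ X := by positivity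
  have hXk : X ^ (k + 1) = (n : ℝ) ^ k := by
    rw [hX, ← Real.rpow_natCast, ← Real.rpow_mul (by positivity), ← Real.rpow_natCast]
    congr 1
    push_cast
    field_simp
  rcases le_total (X - s) 0 with h | h
  · rw [max_eq_right h]
    simp only [ne_eq, OfNat.ofNat_ne_zero, not_false_eq_true, zero_pow, mul_zero]
    positivity
  · rw [max_eq_left h]
    have h1 : (s : ℝ) ^ (k - 1) * (X - s) ^ 2 ≤ X ^ (k + 1) := by
      calc (s : ℝ) ^ (k - 1) * (X - s) ^ 2 ≤ X ^ (k - 1) * X ^ 2 := by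
            gcongr
            · linarith
            · linarith [Nat.cast_nonneg (α := ℝ) s]
        _ = X ^ (k + 1) := by rw [← pow_add]; congr 1; omega
    have h2 := pow_choose n k hk hn
    rw [mul_left_comm, inv_mul_le_iff₀ hN]
    linarith

lemma coef_sq_le (n k : ℕ) (j : Fin n) (V S : Finset (Fin n)) :
    coef n k j V S ^ 2 ≤ ((n.choose k : ℝ))⁻¹
      + if (j ∈ V ∧ V.erase j ⊆ S) then alpha n k S.card ^ 2 else 0 := by
  have h0 : (0 : ℝ) ≤ ((n.choose k : ℝ))⁻¹ := by positivity
  have h1 := alpha_diff n k S.card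
  have h2 := sq_nonneg (alpha n k S.card)
  by_cases hV : V ⊆ S
  · rw [coef_zero _ _ _ _ _ hV]
    split_ifs <;> nlinarith
  by_cases hj : j ∈ S
  · simp only [coef, hj, if_true]
    split_ifs <;> nlinarith
  by_cases hV' : V ⊆ insert j S
  · have hjV : j ∈ V := by
      by_contra hc
      exact hV ((Finset.subset_insert_iff_of_notMem hc).1 hV')
    have : V.erase j ⊆ S := Finset.subset_insert_iff.1 hV'
    simp only [coef, hj, hV, hV', hjV, this, and_self, if_true, if_false]
    nlinarith
  · simp only [coef, hj, hV, hV', if_false]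
    split_ifs <;> nlinarith

lemma sum_coef_sq (n k : ℕ) (hk : 1 ≤ k) (hn : k ≤ n) (j : Fin n) (S : Finset (Fin n)) :
    ∑ V : {V : Finset (Fin n) // V.card = k}, coef n k j V.val S ^ 2
      ≤ 1 + (k : ℝ) ^ k * k.factorial := by
  have hN : (0 : ℝ) < n.choose k := by exact_mod_cast Nat.choose_pos hn
  refine (Finset.sum_le_sum fun V _ => coef_sq_le n k j V.val S).trans ?_
  rw [Finset.sum_add_distrib]
  have hsub : ∀ g : Finset (Fin n) → ℝ,
      ∑ V : {V : Finset (Fin n) // V.card = k}, g V.val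
        = ∑ V ∈ Finset.powersetCard k Finset.univ, g V := fun g =>
    (Finset.sum_subtype _ (by simp [Finset.mem_powersetCard]) _).symm
  rw [hsub (fun _ => ((n.choose k : ℝ))⁻¹),
    hsub (fun V => if (j ∈ V ∧ V.erase j ⊆ S) then alpha n k S.card ^ 2 else 0)]
  refine add_le_add ?_ ?_
  · simp [Finset.card_powersetCard, hN.ne']
  · rw [← Finset.sum_filter, Finset.sum_const, nsmul_eq_mul]
    refine le_trans ?_ (main_term n k S.card hk hn)
    gcongr
    have : #{V ∈ Finset.powersetCard k Finset.univ | j ∈ V ∧ V.erase j ⊆ S}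
        ≤ #(Finset.powersetCard (k - 1) S) := by
      refine Finset.card_le_card_of_injOn (fun V => V.erase j) ?_ ?_
      · intro V hV
        simp only [Finset.coe_filter, Finset.mem_powersetCard, Set.mem_ofPred_eq] at hV
        simp only [Finset.mem_coe, Finset.mem_powersetCard]
        exact ⟨hV.2.2, by rw [Finset.card_erase_of_mem hV.2.1, hV.1.2]⟩
      · intro V hV W hW hVW
        simp only [Finset.coe_filter, Set.mem_ofPred_eq] at hV hW
        have h : V.erase j = W.erase j := hVW
        rw [← Finset.insert_erase hV.2.1, ← Finset.insert_erase hW.2.1, h]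
    rw [Finset.card_powersetCard] at this
    exact_mod_cast this.trans (Nat.choose_le_pow _ _)

/-- the matrix `Γ'` -/
noncomputable def Gp (n k m : ℕ) [NeZero m] (w : ZMod m) (j : Fin n) :
    Matrix (RowIdx n k m w) (Fin n → ZMod m) ℂ :=
  Matrix.of fun r y => (Real.sqrt m : ℂ) * (∑ S, (coef n k j r.1.val S : ℂ) • ES m S) r.2.val y

lemma nsq_Gp (n k m : ℕ) [NeZero m] (hk : 1 ≤ k) (hn : k ≤ n) (w : ZMod m) (j : Fin n)
    (f : (Fin n → ZMod m) → ℂ) :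
    nsq (Gp n k m w j *ᵥ f) ≤ k * (1 + (k : ℝ) ^ k * k.factorial) * nsq f := by
  have hrow : ∀ r : RowIdx n k m w, ‖(Gp n k m w j *ᵥ f) r‖ ^ 2
      = m * ‖((∑ S, (coef n k j r.1.val S : ℂ) • ES m S) *ᵥ f) r.2.val‖ ^ 2 := by
    intro r
    have : (Gp n k m w j *ᵥ f) r = (Real.sqrt m : ℂ) *
        ((∑ S, (coef n k j r.1.val S : ℂ) • ES m S) *ᵥ f) r.2.val := by
      simp only [Gp, Matrix.mulVec, dotProduct, Matrix.of_apply]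
      rw [Finset.mul_sum]
      exact Finset.sum_congr rfl fun y _ => by ring
    rw [this, norm_mul, mul_pow, Complex.norm_real, Real.norm_eq_abs, sq_abs,
      Real.sq_sqrt (by positivity)]
  have hq : ∀ S : Finset (Fin n), 0 ≤ nsq (ES m S *ᵥ f) := fun S => by unfold nsq; positivity
  calc nsq (Gp n k m w j *ᵥ f) = ∑ r, m * ‖((∑ S, (coef n k j r.1.val S : ℂ) • ES m S) *ᵥ f)
          (r : RowIdx n k m w).2.val‖ ^ 2 := Finset.sum_congr rfl fun r _ => hrow r
    _ = ∑ V : {V : Finset (Fin n) // V.card = k}, m * ∑ x : PV m w V.val,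
          ‖((∑ S, (coef n k j V.val S : ℂ) • ES m S) *ᵥ f) x.val‖ ^ 2 := by
        simp_rw [Finset.mul_sum]
        exact Fintype.sum_sigma _
    _ ≤ ∑ V : {V : Finset (Fin n) // V.card = k},
          k * ∑ S, coef n k j V.val S ^ 2 * nsq (ES m S *ᵥ f) := by
        refine Finset.sum_le_sum fun V _ => ?_
        have := nsq_PV w V.val (coef n k j V.val) (coef_zero n k j V.val) f
        rwa [V.2] at this
    _ = k * ∑ S, (∑ V : {V : Finset (Fin n) // V.card = k}, coef n k j V.val S ^ 2)
          * nsq (ES m S *ᵥ f) := by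
        rw [← Finset.mul_sum, Finset.sum_comm]
        simp_rw [Finset.sum_mul]
    _ ≤ k * ∑ S, (1 + (k : ℝ) ^ k * k.factorial) * nsq (ES m S *ᵥ f) := by
        gcongr with S
        · exact hq S
        · exact sum_coef_sq n k hk hn j S
    _ = _ := by rw [← Finset.mul_sum, nsq_total]; ring

lemma nsq_hadamard {n m k : ℕ} [NeZero m] (w : ZMod m) (j : Fin n)
    (B : Matrix (RowIdx n k m w) (Fin n → ZMod m) ℂ) (K : ℝ)
    (hB : ∀ f, nsq (B *ᵥ f) ≤ K * nsq f) (f : (Fin n → ZMod m) → ℂ) :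
    nsq ((Matrix.of fun (r : RowIdx n k m w) (y : Fin n → ZMod m) =>
      B r y * (if r.2.val j ≠ y j then 1 else 0)) *ᵥ f) ≤ 4 * K * nsq f := by
  let fa : ZMod m → (Fin n → ZMod m) → ℂ := fun a y => if a = y j then f y else 0
  have hfa : ∑ a, nsq (fa a) = nsq f := by
    unfold nsq
    rw [Finset.sum_comm]
    refine Finset.sum_congr rfl fun y _ => ?_
    rw [Finset.sum_eq_single (y j)]
    · simp [fa]
    · intro b _ hb; simp [fa, hb]
    · simp
  have hrow : ∀ r : RowIdx n k m w, ((Matrix.of fun (r : RowIdx n k m w) (y : Fin n → ZMod m) =>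
      B r y * (if r.2.val j ≠ y j then 1 else 0)) *ᵥ f) r
      = (B *ᵥ f) r - (B *ᵥ fa (r.2.val j)) r := by
    intro r
    simp only [Matrix.mulVec, dotProduct, Matrix.of_apply, ← Finset.sum_sub_distrib, fa]
    refine Finset.sum_congr rfl fun y _ => ?_
    by_cases h : r.2.val j = y j <;> simp [h]
  have hle : ∀ a b : ℂ, ‖a - b‖ ^ 2 ≤ 2 * ‖a‖ ^ 2 + 2 * ‖b‖ ^ 2 := by
    intro a b
    have h1 := norm_sub_le a b
    have h2 := norm_nonneg (a - b)
    nlinarith [sq_nonneg (‖a‖ - ‖b‖), norm_nonneg a, norm_nonneg b]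
  calc _ ≤ ∑ r, (2 * ‖(B *ᵥ f) r‖ ^ 2 + 2 * ‖(B *ᵥ fa (r.2.val j)) r‖ ^ 2) :=
        Finset.sum_le_sum fun r _ => by rw [hrow r]; exact hle _ _
    _ ≤ ∑ r, (2 * ‖(B *ᵥ f) r‖ ^ 2 + 2 * ∑ a, ‖(B *ᵥ fa a) r‖ ^ 2) := by
        gcongr with r
        exact Finset.single_le_sum (f := fun a => ‖(B *ᵥ fa a) r‖ ^ 2)
          (fun a _ => by positivity) (Finset.mem_univ _)
    _ = 2 * nsq (B *ᵥ f) + 2 * ∑ a, nsq (B *ᵥ fa a) := by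
        unfold nsq
        rw [Finset.sum_add_distrib, ← Finset.mul_sum, ← Finset.mul_sum, Finset.sum_comm]
    _ ≤ 2 * (K * nsq f) + 2 * ∑ a, K * nsq (fa a) := by
        gcongr
        · exact hB f
        · exact hB _
    _ = _ := by rw [← Finset.mul_sum, hfa]; ring

lemma specNorm_le {α β : Type*} [Fintype α] [Fintype β] [DecidableEq β]
    (A : Matrix α β ℂ) (K : ℝ) (hK : 0 ≤ K) (h : ∀ f, nsq (A *ᵥ f) ≤ K * nsq f) :
    specNorm A ≤ Real.sqrt K := by
  unfold specNorm
  refine ContinuousLinearMap.opNorm_le_bound _ (Real.sqrt_nonneg _) fun f => ?_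
  refine le_of_sq_le_sq ?_ (by positivity)
  rw [mul_pow, Real.sq_sqrt hK, EuclideanSpace.norm_sq_eq, EuclideanSpace.norm_sq_eq]
  exact h f.ofLp

end KSum

open KSum in
/-- For each fixed `k ≥ 1` there exists a constant `C` (depending only
on `k`) such that for all `n ≥ k`, `m ≥ 2`, `w ∈ ℤ/mℤ` and `j ∈ {1,…,n}`, the stacked
`k`-SUM adversary matrix satisfies `‖Γ ∘ Δ_j‖ ≤ C`, where
`Δ_j[(V,x), y] = 1` iff `x_j ≠ y_j`. -/
theorem stmt10 (k : ℕ) (hk : 1 ≤ k) :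
    ∃ C : ℝ, ∀ (n m : ℕ) [NeZero m], ∀ (w : ZMod m) (j : Fin n), k ≤ n → 2 ≤ m →
      specNorm (Matrix.of fun (r : RowIdx n k m w) (y : Fin n → ZMod m) =>
          Gamma n k m w r y * (if r.2.val j ≠ y j then 1 else 0))
        ≤ C := by
  refine ⟨Real.sqrt (4 * (k * (1 + (k : ℝ) ^ k * k.factorial))), ?_⟩
  intro n m _ w j hn hm
  have hEq : (Matrix.of fun (r : RowIdx n k m w) (y : Fin n → ZMod m) =>
          Gamma n k m w r y * (if r.2.val j ≠ y j then (1 : ℂ) else 0))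
      = (Matrix.of fun (r : RowIdx n k m w) (y : Fin n → ZMod m) =>
          Gp n k m w j r y * (if r.2.val j ≠ y j then (1 : ℂ) else 0)) := by
    ext r y
    simp only [Matrix.of_apply]
    by_cases h : r.2.val j = y j
    · simp [h]
    · congr 1
      simp only [Gamma, GV, Gp, Matrix.of_apply, Matrix.sum_apply, Matrix.smul_apply, smul_eq_mul]
      rw [sum_coef k r.1.val j r.2.val y h]
  rw [hEq]
  exact specNorm_le _ _ (by positivity)
    (nsq_hadamard w j _ _ (nsq_Gp n k m hk hn w j))
end

section
/- Fix $k\ge 1$. For each $n\ge k$ let $\ell_n\ge 2$ and $m_n$ be integers with $m_n/n^{k+2/(k+1)}\to\infty$, let $w_n\in\mathbb{Z}/m_n\mathbb{Z}$, and let $\mathcal{S}_n$ be a $T_n$-query quantum algorithm for the search version of the composed problem $k\text{-SUM}\circ\text{pSEARCH}_{\ell_n}^n$ (in the concrete query model: the input is $z:\{1,\dots,n\}\times\{1,\dots,\ell_n\}\to(\mathbb{Z}/m_n\mathbb{Z})\cup\{\star\}$ with exactly one non-$\star$ entry $t_i$ in each bucket $i$; unitaries interleaved with the oracle $O_z$,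 followed by a projective measurement whose outcomes are $k$-subsets of $\{1,\dots,n\}$ plus failure). Let $\nu_n$ be the probability, averaged over inputs drawn from the planted composed distribution, that the measured $k$-subset $S$ satisfies $\sum_{i\in S}t_i=w_n$. If $\liminf_n \nu_n>0$, then there exist $c>0$ and $N$ such that $T_n \ge c\,\nu_n\sqrt{\ell_n-1}\;n^{k/(k+1)}$ for all $n\ge N$. -/
noncomputable section

/-- Index set of the state space for an input with coordinates indexed by `J` over the
alphabet `ℤ/Mℤ`: `(ℤ/Mℤ) × (J ∪ {0}) × W`, with `none` playing the role of the
non-query index `0`. -/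
abbrev QIdx (M : ℕ) (J W : Type) : Type := ZMod M × Option J × W

/-- The Hilbert space `ℂ^{(ℤ/Mℤ) × (J ∪ {0}) × W}`. -/
abbrev QSpace (M : ℕ) (J W : Type) : Type := EuclideanSpace ℂ (QIdx M J W)

/-- The permutation of basis indices underlying the oracle `O_z`:
`(a, j, w) ↦ (a + z_j, j, w)` for `j ∈ J` and `(a, 0, w) ↦ (a, 0, w)`. -/
def oracleEquiv (M : ℕ) {J W : Type} (z : J → ZMod M) :
    QIdx M J W ≃ QIdx M J W where
  toFun p := (p.1 + p.2.1.elim 0 z, p.2)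
  invFun p := (p.1 - p.2.1.elim 0 z, p.2)
  left_inv p := by simp
  right_inv p := by simp

/-- The oracle unitary `O_z`, sending the standard basis vector `|a,j,w⟩` to
`|a + z_j, j, w⟩` for `j ∈ J` and fixing `|a,0,w⟩`. -/
def oracle (M : ℕ) [NeZero M] {J W : Type} [Fintype J] [Fintype W] (z : J → ZMod M) :
    QSpace M J W ≃ₗᵢ[ℂ] QSpace M J W :=
  LinearIsometryEquiv.piLpCongrLeft 2 ℂ ℂ (oracleEquiv M z)

/-- The state of the algorithm after `t` queries:
`stateAfter U Oz ψ₀ t = U_t O_z U_{t-1} O_z ⋯ U_1 O_z U_0 ψ₀`. -/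
def stateAfter (M : ℕ) [NeZero M] (J W : Type) [Fintype J] [Fintype W]
    (U : ℕ → QSpace M J W ≃ₗᵢ[ℂ] QSpace M J W)
    (Oz : QSpace M J W ≃ₗᵢ[ℂ] QSpace M J W) (ψ0 : QSpace M J W) : ℕ → QSpace M J W
  | 0 => U 0 ψ0
  | t + 1 => U (t + 1) (Oz (stateAfter M J W U Oz ψ0 t))

/-- The point probability of `t ∈ (ℤ/mℤ)ⁿ` under the planted distribution:
choose a uniform `k`-subset `U`, a uniform tuple on `U` summing to `w`, and uniform
values elsewhere; explicitly `#{U : |U| = k, ∑_{i∈U} t_i = w} / ((n choose k)·m^{n-1})`. -/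
def plantedProb (n k m : ℕ) [NeZero m] (w : ZMod m) (t : Fin n → ZMod m) : ℝ :=
  ((Finset.univ.filter fun U : Finset (Fin n) =>
      U.card = k ∧ ∑ i ∈ U, t i = w).card : ℝ)
    / ((n.choose k : ℝ) * (m : ℝ) ^ (n - 1))

/-- The bucket encoding of values `t : Fin n → ℤ/mℤ` at positions `r : Fin n → Fin ℓ`:
the input string `z` over the alphabet `(ℤ/mℤ) ∪ {⋆}`, identified with `ℤ/(m+1)ℤ`
(values `0,…,m-1` are the group elements and `m` is `⋆`), having `t i` at position
`r i` of bucket `i` and `⋆` everywhere else. -/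
def encode (n ℓ m : ℕ) [NeZero m] (t : Fin n → ZMod m) (r : Fin n → Fin ℓ) :
    Fin n × Fin ℓ → ZMod (m + 1) :=
  fun ij => if ij.2 = r ij.1 then ((t ij.1).val : ZMod (m + 1)) else (m : ZMod (m + 1))

set_option linter.unusedSectionVars false

namespace KS
open scoped InnerProductSpace

section layer0
variable {ι X H : Type*} [Fintype ι] [DecidableEq ι] [Fintype X]
  [NormedAddCommGroup H] [InnerProductSpace ℂ H]

abbrev Sp (ι X H : Type*) [Fintype ι] [Fintype X] [DecidableEq ι]
  [NormedAddCommGroup H] [InnerProductSpace ℂ H] := PiLp 2 (fun _ : ι → X => H)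

/-- pointwise operator -/
def diagOp (G : (ι → X) → Module.End ℂ H) : Module.End ℂ (Sp ι X H) where
  toFun f := WithLp.toLp 2 (fun x => G x (f x))
  map_add' f g := by ext x; simp
  map_smul' c f := by ext x; simp

/-- averaging over coordinate `i` -/
def avgOp (i : ι) : Module.End ℂ (Sp ι X H) where
  toFun f := WithLp.toLp 2 (fun x => ((Fintype.card X : ℂ)⁻¹) • ∑ y, f (Function.update x i y))
  map_add' f g := by ext x; simp [Finset.sum_add_distrib]
  map_smul' c f := by ext x; simp [← Finset.smul_sum, smul_comm c]

lemma diagOp_apply (G : (ι → X) → Module.End ℂ H) (f : Sp ι X H) (x : ι → X) :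
    diagOp G f x = G x (f x) := rfl

lemma avgOp_apply (i : ι) (f : Sp ι X H) (x : ι → X) :
    avgOp i f x = ((Fintype.card X : ℂ)⁻¹) • ∑ y, f (Function.update x i y) := rfl

lemma diagOp_mul (G G' : (ι → X) → Module.End ℂ H) :
    diagOp G * diagOp G' = diagOp (fun x => G x * G' x) := rfl

lemma sum_swap {β : Type*} [AddCommMonoid β] (i : ι) (F : (ι → X) → (ι → X) → β) :
    ∑ x : ι → X, ∑ y, F (Function.update x i y) x = ∑ x, ∑ y, F x (Function.update x i y) := by
  rw [← Fintype.sum_prod_type', ← Fintype.sum_prod_type']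
  let e : (ι → X) × X → (ι → X) × X := fun p => (Function.update p.1 i p.2, p.1 i)
  have he : Function.Involutive e := by
    rintro ⟨x, y⟩
    simp [e]
  refine Fintype.sum_equiv he.toPerm _ _ ?_
  rintro ⟨x, y⟩
  simp [e]

lemma sum_update {β : Type*} [AddCommMonoid β] (i : ι) (F : (ι → X) → β) :
    ∑ x : ι → X, ∑ y, F (Function.update x i y) = Fintype.card X • ∑ x, F x := by
  rw [sum_swap i (fun a _ => F a)]
  simp [Finset.smul_sum]

lemma normsq (f : Sp ι X H) : ‖f‖ ^ 2 = ∑ x, ‖f x‖ ^ 2 :=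
  PiLp.norm_sq_eq_of_L2 _ f

lemma avg_sa (i : ι) (f g : Sp ι X H) : ⟪avgOp i f, g⟫_ℂ = ⟪f, avgOp i g⟫_ℂ := by
  simp only [PiLp.inner_apply, avgOp_apply, inner_smul_left, inner_smul_right, sum_inner,
    inner_sum]
  simp only [← Finset.mul_sum]
  rw [sum_swap i (fun a b => ⟪f a, g b⟫_ℂ)]
  simp

lemma avg_inv (i : ι) (f : Sp ι X H) (x : ι → X) (y : X) :
    avgOp i f (Function.update x i y) = avgOp i f x := by
  simp [avgOp_apply]

lemma avg_comm (i j : ι) : Commute (avgOp i : Module.End ℂ (Sp ι X H)) (avgOp j) := by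
  by_cases h : i = j
  · subst h; exact Commute.refl _
  ext f x
  simp only [Module.End.mul_apply, avgOp_apply, ← Finset.smul_sum]
  rw [Finset.sum_comm]
  congr 3
  ext y; congr 1; ext z
  rw [Function.update_comm h]

lemma diag_avg_comm (i : ι) (G : (ι → X) → Module.End ℂ H)
    (hG : ∀ x y, G (Function.update x i y) = G x) :
    Commute (diagOp G) (avgOp i) := by
  ext f x
  simp [Module.End.mul_apply, avgOp_apply, diagOp_apply, hG]

variable [Nonempty X]

lemma avg_idem (i : ι) : (avgOp i * avgOp i : Module.End ℂ (Sp ι X H)) = avgOp i := by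
  ext f x
  have hc : (Fintype.card X : ℂ) ≠ 0 := by simp
  rw [Module.End.mul_apply, avgOp_apply]
  simp only [avg_inv]
  rw [Finset.sum_const, Finset.card_univ, ← Nat.cast_smul_eq_nsmul ℂ, smul_smul,
    inv_mul_cancel₀ hc, one_smul]

lemma norm_diag_avg (i : ι) (G : (ι → X) → Module.End ℂ H) (c : ℝ)
    (hG : ∀ x v, ∑ y, ‖G (Function.update x i y) v‖ ^ 2 ≤ c ^ 2 * Fintype.card X * ‖v‖ ^ 2)
    (hc : 0 ≤ c) (f : Sp ι X H) : ‖diagOp G (avgOp i f)‖ ≤ c * ‖avgOp i f‖ := by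
  have hX : (0 : ℝ) < Fintype.card X := by exact_mod_cast Fintype.card_pos
  refine (sq_le_sq₀ (by positivity) (by positivity)).1 ?_
  rw [mul_pow, normsq, normsq]
  have := sum_update i (fun x => ‖diagOp G (avgOp i f) x‖ ^ 2)
  simp only [diagOp_apply, avg_inv] at this ⊢
  rw [nsmul_eq_mul] at this
  have h2 : ∑ x, ∑ y, ‖G (Function.update x i y) (avgOp i f x)‖ ^ 2
      ≤ ∑ x, c ^ 2 * Fintype.card X * ‖avgOp i f x‖ ^ 2 :=
    Finset.sum_le_sum fun x _ => hG x _
  rw [this, ← Finset.mul_sum] at h2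
  nlinarith
end layer0

section proj
variable {V : Type*} [NormedAddCommGroup V] [InnerProductSpace ℂ V]

lemma proj_pyth (P : Module.End ℂ V) (hP : P * P = P) (hsa : ∀ f g, ⟪P f, g⟫_ℂ = ⟪f, P g⟫_ℂ)
    (f : V) : ‖f‖ ^ 2 = ‖P f‖ ^ 2 + ‖f - P f‖ ^ 2 := by
  have hp : P (P f) = P f := by rw [← Module.End.mul_apply, hP]
  have h0 : ⟪P f, f - P f⟫_ℂ = 0 := by
    rw [hsa, map_sub, hp, sub_self, inner_zero_right]
  have := norm_add_sq_eq_norm_sq_add_norm_sq_of_inner_eq_zero (𝕜 := ℂ) (P f) (f - P f) h0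
  simp only [add_sub_cancel] at this
  simpa [sq] using this

lemma proj_le (P : Module.End ℂ V) (hP : P * P = P) (hsa : ∀ f g, ⟪P f, g⟫_ℂ = ⟪f, P g⟫_ℂ)
    (f : V) : ‖P f‖ ≤ ‖f‖ := by
  have := proj_pyth P hP hsa f
  refine (sq_le_sq₀ (by positivity) (by positivity)).1 ?_
  nlinarith [sq_nonneg ‖f - P f‖]

lemma proj_compl_le (P : Module.End ℂ V) (hP : P * P = P)
    (hsa : ∀ f g, ⟪P f, g⟫_ℂ = ⟪f, P g⟫_ℂ)
    (f : V) : ‖f - P f‖ ≤ ‖f‖ := by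
  have := proj_pyth P hP hsa f
  refine (sq_le_sq₀ (by positivity) (by positivity)).1 ?_
  nlinarith [sq_nonneg ‖P f‖]
end proj

section comb
variable {ι : Type*} [Fintype ι] [DecidableEq ι]

lemma sum_erase_le (j : ℕ) (g : Finset ι → ι → ℝ) (hg : ∀ S i, 0 ≤ g S i) :
    ∑ S ∈ Finset.powersetCard (j + 1) (Finset.univ : Finset ι), ∑ i ∈ S, g (S.erase i) i
      ≤ ∑ S ∈ Finset.powersetCard j (Finset.univ : Finset ι), ∑ i, g S i := by
  rw [Finset.sum_sigma', Finset.sum_sigma']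
  let φ : (Σ _ : Finset ι, ι) → (Σ _ : Finset ι, ι) := fun p => ⟨p.1.erase p.2, p.2⟩
  have hinj : Set.InjOn φ ((Finset.powersetCard (j + 1) (Finset.univ : Finset ι)).sigma
      (fun S => S) : Finset (Σ _ : Finset ι, ι)) := by
    rintro ⟨S, i⟩ h ⟨S', i'⟩ h' he
    simp [φ] at h h' he ⊢
    obtain ⟨he, rfl⟩ := he
    refine ⟨?_, rfl⟩
    rw [← Finset.insert_erase h.2, he, Finset.insert_erase h'.2]
  rw [← Finset.sum_image (s := (Finset.powersetCard (j + 1) (Finset.univ : Finset ι)).sigma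
      (fun S => S)) (g := φ) (f := fun p => g p.1 p.2) hinj]
  refine Finset.sum_le_sum_of_subset_of_nonneg ?_ (fun _ _ _ => hg _ _)
  intro p hp
  simp only [Finset.mem_image, Finset.mem_sigma, Finset.mem_powersetCard, φ] at hp ⊢
  obtain ⟨⟨S, i⟩, ⟨⟨_, hS⟩, hi⟩, rfl⟩ := hp
  simp [Finset.card_erase_of_mem hi, hS]
end comb

section layer1
structure AS (ι V : Type*) [Fintype ι] [DecidableEq ι]
    [NormedAddCommGroup V] [InnerProductSpace ℂ V] where
  A : ι → Module.End ℂ V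
  Q : Option ι → Module.End ℂ V
  O : Module.End ℂ V
  E : Finset ι → Module.End ℂ V
  δ : ℝ
  ε : ℝ
  η : ℝ
  hδ : 0 ≤ δ
  hδ2 : δ ≤ 2
  hε : 0 ≤ ε
  hη : 0 ≤ η
  hAidem : ∀ i, A i * A i = A i
  hAle : ∀ i f, ‖A i f‖ ≤ ‖f‖
  hBle : ∀ i f, ‖f - A i f‖ ≤ ‖f‖
  hAA : ∀ i j, Commute (A i) (A j)
  hQA : ∀ o i, Commute (Q o) (A i)
  hQO : ∀ o, Commute (Q o) O
  hQE : ∀ o S, Commute (Q o) (E S)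
  hQidem : ∀ o, Q o * Q o = Q o
  hQsum : ∀ f, ∑ o, ‖Q o f‖ ^ 2 = ‖f‖ ^ 2
  hOA : ∀ o i, o ≠ some i → Commute (O * Q o) (A i)
  hO : ∀ f, ‖O f‖ = ‖f‖
  hOE : ∀ S, Commute O (E S)
  h1 : ∀ i φ, Q (some i) φ = φ → ‖(1 - A i) (O φ)‖ ≤ ‖(1 - A i) φ‖ + δ * ‖φ‖
  h2 : ∀ i S, i ∈ S → ∀ φ, Q (some i) φ = φ →
    ‖E S ((1 - A i) (O φ))‖ ≤ ‖E S ((1 - A i) φ)‖ + ε * ‖φ‖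
  h3 : ∀ i S, i ∈ S → ∀ φ, ‖E S (A i φ)‖ ≤ η * ‖φ‖

namespace AS
variable {ι V : Type*} [Fintype ι] [DecidableEq ι]
    [NormedAddCommGroup V] [InnerProductSpace ℂ V] (s : AS ι V)

lemma bcomm (S : Finset ι) : (S : Set ι).Pairwise (Function.onFun Commute (fun i => 1 - s.A i)) := by
  intro i _ j _ _
  have := s.hAA i j
  exact ((Commute.one_left _).sub_left (((Commute.one_right _)).sub_right this))

def BV (S : Finset ι) : Module.End ℂ V := S.noncommProd (fun i => 1 - s.A i) (s.bcomm S)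

lemma BV_empty : s.BV ∅ = 1 := by simp [BV]

lemma BV_erase (S : Finset ι) (i : ι) (hi : i ∈ S) : s.BV S = (1 - s.A i) * s.BV (S.erase i) := by
  unfold BV
  exact (Finset.mul_noncommProd_erase S hi (fun i => 1 - s.A i) (s.bcomm S)).symm

lemma BV_insert (S : Finset ι) (i : ι) (hi : i ∉ S) :
    s.BV (insert i S) = (1 - s.A i) * s.BV S := by
  rw [s.BV_erase _ i (by simp), Finset.erase_insert hi]

lemma BV_comm (S : Finset ι) (C : Module.End ℂ V) (h : ∀ i ∈ S, Commute C (s.A i)) :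
    Commute C (s.BV S) := by
  refine Finset.noncommProd_commute _ _ _ _ ?_
  intro i hi
  exact (Commute.one_right _).sub_right (h i hi)

lemma B_le (i : ι) (f : V) : ‖(1 - s.A i) f‖ ≤ ‖f‖ := by
  simpa using s.hBle i f

lemma BV_le_erase (S : Finset ι) (i : ι) (hi : i ∈ S) (f : V) :
    ‖s.BV S f‖ ≤ ‖s.BV (S.erase i) f‖ := by
  rw [s.BV_erase S i hi]; exact s.B_le i _

lemma BV_le (S : Finset ι) (f : V) : ‖s.BV S f‖ ≤ ‖f‖ := by
  induction S using Finset.induction_on with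
  | empty => simp [BV_empty]
  | insert i S hi ih =>
    rw [s.BV_insert S i hi]
    exact (s.B_le i _).trans ih

lemma BV_zero (S : Finset ι) (hS : S.Nonempty) (f : V) (hf : ∀ i, s.A i f = f) :
    s.BV S f = 0 := by
  obtain ⟨i, hi⟩ := hS
  rw [s.BV_erase S i hi]
  have : Commute (1 - s.A i) (s.BV (S.erase i)) :=
    s.BV_comm _ _ fun j _ => (Commute.one_left _).sub_left (s.hAA i j)
  rw [this.eq, Module.End.mul_apply]
  simp [hf]

lemma E_one_sub (S : Finset ι) (f : V) : ‖s.E S (f - s.BV S f)‖ ≤ S.card * s.η * ‖f‖ := by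
  have key : ∀ R : Finset ι, R ⊆ S → ‖s.E S (f - s.BV R f)‖ ≤ R.card * s.η * ‖f‖ := by
    intro R
    induction R using Finset.induction_on with
    | empty => simp [BV_empty]
    | insert i R hi ih =>
      intro hR
      have hR' := (Finset.insert_subset_iff.1 hR)
      have e : f - s.BV (insert i R) f = (f - s.BV R f) + s.A i (s.BV R f) := by
        rw [s.BV_insert R i hi, Module.End.mul_apply]; simp; abel
      rw [e, map_add, Finset.card_insert_of_notMem hi]
      refine (norm_add_le _ _).trans ?_
      have h3 := s.h3 i S hR'.1 (s.BV R f)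
      have := mul_le_mul_of_nonneg_left (s.BV_le R f) s.hη
      have := ih hR'.2
      push_cast
      linarith
  exact key S subset_rfl

def M (j : ℕ) (f : V) : ℝ := ∑ S ∈ Finset.powersetCard j (Finset.univ : Finset ι), ‖s.BV S f‖ ^ 2
def Φ (j : ℕ) (f : V) : ℝ :=
  ∑ S ∈ Finset.powersetCard j (Finset.univ : Finset ι), ‖s.E S (s.BV S f)‖ ^ 2

lemma M_nonneg (j : ℕ) (f : V) : 0 ≤ s.M j f := Finset.sum_nonneg fun _ _ => by positivity

lemma M_zero (f : V) : s.M 0 f = ‖f‖ ^ 2 := by simp [M, BV_empty]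

/-- commutation away from the queried bucket -/
lemma BV_O_Q (S : Finset ι) (o : Option ι) (ho : ∀ i ∈ S, o ≠ some i) (f : V) :
    s.BV S (s.O (s.Q o f)) = s.O (s.BV S (s.Q o f)) := by
  have h := (s.BV_comm S (s.O * s.Q o) (fun i hi => s.hOA o i (ho i hi))).eq
  have h' := (s.BV_comm S (s.Q o) (fun i hi => s.hQA o i)).eq
  have h1 := congrArg (fun C => C f) h
  have h2 := congrArg (fun C => C f) h'
  simp only [Module.End.mul_apply] at h1 h2
  rw [← h1, h2]

lemma BV_Q (S : Finset ι) (o : Option ι) (f : V) :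
    s.Q o (s.BV S f) = s.BV S (s.Q o f) := by
  have h' := (s.BV_comm S (s.Q o) (fun i hi => s.hQA o i)).eq
  exact congrArg (fun C => C f) h'

lemma O_Q (o : Option ι) (f : V) : s.Q o (s.O f) = s.O (s.Q o f) :=
  congrArg (fun C => C f) (s.hQO o).eq

lemma E_Q (S : Finset ι) (o : Option ι) (f : V) : s.Q o (s.E S f) = s.E S (s.Q o f) :=
  congrArg (fun C => C f) (s.hQE o S).eq

lemma O_E (S : Finset ι) (f : V) : s.O (s.E S f) = s.E S (s.O f) :=
  congrArg (fun C => C f) (s.hOE S).eq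

lemma Q_Q (o : Option ι) (f : V) : s.Q o (s.Q o f) = s.Q o f :=
  congrArg (fun C => C f) (s.hQidem o)

/-- extra term -/
def bt (S : Finset ι) (f : V) (o : Option ι) : ℝ :=
  o.elim 0 (fun i => if i ∈ S then ‖s.BV (S.erase i) (s.Q (some i) f)‖ else 0)

lemma bt_nonneg (S : Finset ι) (f : V) (o : Option ι) : 0 ≤ s.bt S f o := by
  cases o with
  | none => simp [bt]
  | some i => simp only [bt, Option.elim]; split_ifs <;> positivity

lemma bt_sum (j : ℕ) (f : V) :
    ∑ S ∈ Finset.powersetCard (j + 1) (Finset.univ : Finset ι), ∑ o, s.bt S f o ^ 2 ≤ s.M j f := by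
  have h : ∀ S : Finset ι, ∑ o, s.bt S f o ^ 2
      = ∑ i ∈ S, ‖s.BV (S.erase i) (s.Q (some i) f)‖ ^ 2 := by
    intro S
    rw [Fintype.sum_option]
    simp [bt, ite_pow]
  simp only [h]
  refine (sum_erase_le j (fun S i => ‖s.BV S (s.Q (some i) f)‖ ^ 2)
    (fun _ _ => by positivity)).trans ?_
  unfold M
  refine Finset.sum_le_sum fun S _ => ?_
  rw [← s.hQsum (s.BV S f), Fintype.sum_option]
  simp only [BV_Q]
  have : 0 ≤ ‖s.BV S (s.Q none f)‖ ^ 2 := by positivity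
  linarith

lemma M_term (S : Finset ι) (f : V) (o : Option ι) :
    ‖s.BV S (s.O (s.Q o f))‖ ^ 2 ≤ ‖s.BV S (s.Q o f)‖ ^ 2 + 4 * s.δ * s.bt S f o ^ 2 := by
  by_cases ho : ∀ i ∈ S, o ≠ some i
  · rw [s.BV_O_Q S o ho, s.hO]
    have := s.hδ
    have : 0 ≤ 4 * s.δ * s.bt S f o ^ 2 := by positivity
    linarith
  · push Not at ho
    obtain ⟨i, hi, rfl⟩ := ho
    rw [s.BV_erase S i hi, Module.End.mul_apply, Module.End.mul_apply,
      s.BV_O_Q (S.erase i) (some i) (by intro j hj h; simp at h; simp [h] at hj)]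
    have hb : s.bt S f (some i) = ‖s.BV (S.erase i) (s.Q (some i) f)‖ := by simp [bt, hi]
    rw [hb]
    set φ := s.BV (S.erase i) (s.Q (some i) f) with hφ
    have hq : s.Q (some i) φ = φ := by rw [hφ, BV_Q, Q_Q]
    have h1 := s.h1 i φ hq
    have h2 := s.B_le i φ
    have := s.hδ
    have := s.hδ2
    have hn := norm_nonneg φ
    have hn2 := norm_nonneg ((1 - s.A i) φ)
    calc _ ≤ (‖(1 - s.A i) φ‖ + s.δ * ‖φ‖) ^ 2 := by gcongr
      _ = ‖(1 - s.A i) φ‖ ^ 2 + 2 * s.δ * ‖φ‖ * ‖(1 - s.A i) φ‖ + s.δ * s.δ * ‖φ‖ ^ 2 := by ring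
      _ ≤ ‖(1 - s.A i) φ‖ ^ 2 + 2 * s.δ * ‖φ‖ * ‖φ‖ + s.δ * 2 * ‖φ‖ ^ 2 := by gcongr
      _ = _ := by ring

lemma M_step (j : ℕ) (f : V) : s.M (j + 1) (s.O f) ≤ s.M (j + 1) f + 4 * s.δ * s.M j f := by
  have hs : s.M (j + 1) (s.O f) ≤
      ∑ S ∈ Finset.powersetCard (j + 1) (Finset.univ : Finset ι),
        (‖s.BV S f‖ ^ 2 + 4 * s.δ * ∑ o, s.bt S f o ^ 2) := by
    refine Finset.sum_le_sum fun S _ => ?_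
    rw [← s.hQsum (s.BV S (s.O f)), ← s.hQsum (s.BV S f), Finset.mul_sum, ← Finset.sum_add_distrib]
    refine Finset.sum_le_sum fun o _ => ?_
    rw [BV_Q, BV_Q, O_Q]
    exact s.M_term S f o
  refine hs.trans ?_
  rw [Finset.sum_add_distrib, ← Finset.mul_sum]
  have := s.bt_sum j f
  have := s.hδ
  unfold M at *
  gcongr

lemma Φ_term (S : Finset ι) (f : V) (o : Option ι) :
    ‖s.E S (s.BV S (s.O (s.Q o f)))‖ ≤ ‖s.E S (s.BV S (s.Q o f))‖ + s.ε * s.bt S f o := by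
  by_cases ho : ∀ i ∈ S, o ≠ some i
  · rw [s.BV_O_Q S o ho, ← O_E, s.hO]
    have := s.hε
    have := s.bt_nonneg S f o
    have : 0 ≤ s.ε * s.bt S f o := by positivity
    linarith
  · push Not at ho
    obtain ⟨i, hi, rfl⟩ := ho
    rw [s.BV_erase S i hi, Module.End.mul_apply, Module.End.mul_apply,
      s.BV_O_Q (S.erase i) (some i) (by intro j hj h; simp at h; simp [h] at hj)]
    have hb : s.bt S f (some i) = ‖s.BV (S.erase i) (s.Q (some i) f)‖ := by simp [bt, hi]
    rw [hb]
    exact s.h2 i S hi _ (by rw [BV_Q, Q_Q])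

lemma mink {α : Type*} (t : Finset α) (a b c : α → ℝ) (ha : ∀ x, 0 ≤ a x) (h : ∀ x, a x ≤ b x + c x) :
    √(∑ x ∈ t, a x ^ 2) ≤ √(∑ x ∈ t, b x ^ 2) + √(∑ x ∈ t, c x ^ 2) := by
  have hb : 0 ≤ ∑ x ∈ t, b x ^ 2 := Finset.sum_nonneg fun _ _ => sq_nonneg _
  have hc : 0 ≤ ∑ x ∈ t, c x ^ 2 := Finset.sum_nonneg fun _ _ => sq_nonneg _
  rw [Real.sqrt_le_left (by positivity)]
  have cs := Finset.sum_mul_sq_le_sq_mul_sq t b c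
  have cs2 : ∑ x ∈ t, b x * c x ≤ √(∑ x ∈ t, b x ^ 2) * √(∑ x ∈ t, c x ^ 2) := by
    rw [← Real.sqrt_mul hb]
    exact Real.le_sqrt_of_sq_le cs
  calc _ ≤ ∑ x ∈ t, (b x + c x) ^ 2 := Finset.sum_le_sum fun x _ => by
        have := ha x; have := h x; gcongr
    _ = ∑ x ∈ t, b x ^ 2 + 2 * ∑ x ∈ t, b x * c x + ∑ x ∈ t, c x ^ 2 := by
        rw [Finset.mul_sum, ← Finset.sum_add_distrib, ← Finset.sum_add_distrib]
        exact Finset.sum_congr rfl fun x _ => by ring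
    _ ≤ _ := by
        rw [add_sq, Real.sq_sqrt hb, Real.sq_sqrt hc]
        linarith

lemma Φ_step (j : ℕ) (f : V) :
    √(s.Φ (j + 1) (s.O f)) ≤ √(s.Φ (j + 1) f) + s.ε * √(s.M j f) := by
  have e : ∀ g : V, s.Φ (j + 1) g = ∑ p ∈ Finset.powersetCard (j + 1) (Finset.univ : Finset ι) ×ˢ
      (Finset.univ : Finset (Option ι)), ‖s.E p.1 (s.BV p.1 (s.Q p.2 g))‖ ^ 2 := by
    intro g
    rw [Finset.sum_product]
    refine Finset.sum_congr rfl fun S _ => ?_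
    rw [← s.hQsum]
    simp only [E_Q, BV_Q]
  rw [e, e]
  refine (mink _ _ (fun p => ‖s.E p.1 (s.BV p.1 (s.Q p.2 f))‖) (fun p => s.ε * s.bt p.1 f p.2)
    (fun _ => norm_nonneg _) ?_).trans ?_
  · rintro ⟨S, o⟩
    simp only [O_Q]
    exact s.Φ_term S f o
  · gcongr
    rw [Real.sqrt_le_left (by have := s.hε; positivity), mul_pow, Real.sq_sqrt (s.M_nonneg _ _)]
    simp only [mul_pow]
    rw [← Finset.mul_sum, Finset.sum_product]
    gcongr
    exact s.bt_sum j f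

/-- The evolution bound. `ψ` is the sequence of states. -/
lemma evolve (Uop : ℕ → Module.End ℂ V) (ψ : ℕ → V)
    (hstep : ∀ t, ψ (t + 1) = Uop (t + 1) (s.O (ψ t)))
    (hU : ∀ t f, ‖Uop t f‖ = ‖f‖) (hUA : ∀ t i, Commute (Uop t) (s.A i))
    (hUE : ∀ t S, Commute (Uop t) (s.E S)) (h0 : ∀ i, s.A i (ψ 0) = ψ 0) :
    (∀ t, ‖ψ t‖ = ‖ψ 0‖) ∧
    (∀ j t, s.M j (ψ t) ≤ (4 * s.δ * t) ^ j * ‖ψ 0‖ ^ 2) ∧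
    (∀ j t, √(s.Φ (j + 1) (ψ t)) ≤ t * s.ε * √((4 * s.δ * t) ^ j * ‖ψ 0‖ ^ 2)) := by
  have hδ := s.hδ
  have hε := s.hε
  have hUB : ∀ t S f, s.BV S (Uop t f) = Uop t (s.BV S f) := fun t S f =>
    (congrArg (fun C => C f) (s.BV_comm S (Uop t) (fun i _ => hUA t i)).eq).symm
  have hUE' : ∀ t S f, s.E S (Uop t f) = Uop t (s.E S f) := fun t S f =>
    (congrArg (fun C => C f) (hUE t S).eq).symm
  have hM : ∀ j t f, s.M j (Uop t f) = s.M j f := by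
    intro j t f; simp only [M, hUB, hU]
  have hΦ : ∀ j t f, s.Φ j (Uop t f) = s.Φ j f := by
    intro j t f; simp only [Φ, hUB, hUE', hU]
  have hn : ∀ t, ‖ψ t‖ = ‖ψ 0‖ := by
    intro t
    induction t with
    | zero => rfl
    | succ t ih => rw [hstep, hU, s.hO, ih]
  have hz : ∀ j, ∀ S ∈ Finset.powersetCard (j + 1) (Finset.univ : Finset ι), s.BV S (ψ 0) = 0 := by
    intro j S hS
    refine s.BV_zero S ?_ _ h0
    rw [← Finset.card_pos, (Finset.mem_powersetCard.1 hS).2]; omega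
  have hMM : ∀ j t, s.M j (ψ t) ≤ (4 * s.δ * t) ^ j * ‖ψ 0‖ ^ 2 := by
    intro j
    induction j with
    | zero => intro t; simp [M_zero, hn]
    | succ j ihj =>
      intro t
      induction t with
      | zero =>
        have : s.M (j + 1) (ψ 0) = 0 := Finset.sum_eq_zero fun S hS => by simp [hz j S hS]
        simp [this]
      | succ t ih =>
        rw [hstep, hM]
        refine (s.M_step j _).trans ?_
        have h1 := ihj t
        push_cast
        calc _ ≤ (4 * s.δ * t) ^ (j + 1) * ‖ψ 0‖ ^ 2
              + 4 * s.δ * ((4 * s.δ * t) ^ j * ‖ψ 0‖ ^ 2) := by gcongr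
          _ = (4 * s.δ * t) ^ j * (4 * s.δ * (t + 1)) * ‖ψ 0‖ ^ 2 := by ring
          _ ≤ (4 * s.δ * (t + 1)) ^ j * (4 * s.δ * (t + 1)) * ‖ψ 0‖ ^ 2 := by
            gcongr; linarith
          _ = _ := by ring
  refine ⟨hn, hMM, ?_⟩
  intro j t
  induction t with
  | zero =>
    have : s.Φ (j + 1) (ψ 0) = 0 := Finset.sum_eq_zero fun S hS => by simp [hz j S hS]
    simp [this]
  | succ t ih =>
    rw [hstep, hΦ]
    refine (s.Φ_step j _).trans ?_
    have h1 := hMM j t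
    have h2 : √((4 * s.δ * t) ^ j * ‖ψ 0‖ ^ 2) ≤ √((4 * s.δ * (t + 1)) ^ j * ‖ψ 0‖ ^ 2) := by
      gcongr; linarith
    have h3 : √(s.M j (ψ t)) ≤ √((4 * s.δ * t) ^ j * ‖ψ 0‖ ^ 2) := Real.sqrt_le_sqrt h1
    push_cast
    calc _ ≤ t * s.ε * √((4 * s.δ * t) ^ j * ‖ψ 0‖ ^ 2)
          + s.ε * √((4 * s.δ * t) ^ j * ‖ψ 0‖ ^ 2) := by gcongr
      _ = (t + 1) * s.ε * √((4 * s.δ * t) ^ j * ‖ψ 0‖ ^ 2) := by ring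
      _ ≤ _ := by gcongr

/-- The success bound. -/
lemma success (j : ℕ) (P : {S : Finset ι // S.card = j + 1} → Module.End ℂ V)
    (hPA : ∀ S i, Commute (P S) (s.A i)) (hPE : ∀ S S', Commute (P S) (s.E S'))
    (hP : ∀ S f, ‖P S f‖ ≤ ‖f‖) (hPs : ∀ f, ∑ S, ‖P S f‖ ^ 2 ≤ ‖f‖ ^ 2) (f : V) :
    ∑ S : {S : Finset ι // S.card = j + 1}, ‖s.E S (P S f)‖ ^ 2 ≤
      2 * s.Φ (j + 1) f + 2 * ((j + 1) * s.η) ^ 2 * ‖f‖ ^ 2 := by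
  have hη := s.hη
  have hΦ : s.Φ (j + 1) f = ∑ S : {S : Finset ι // S.card = j + 1}, ‖s.E S (s.BV S f)‖ ^ 2 := by
    unfold Φ
    refine (Finset.sum_subtype _ ?_ _)
    simp
  have h : ∀ S : {S : Finset ι // S.card = j + 1}, ‖s.E S (P S f)‖ ^ 2 ≤
      2 * ‖s.E S (s.BV S f)‖ ^ 2 + 2 * ((j + 1) * s.η) ^ 2 * ‖P S f‖ ^ 2 := by
    intro S
    have e : s.E S (P S f) = P S (s.E S (s.BV S f)) + s.E S (P S f - s.BV S (P S f)) := by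
      have a1 : s.BV S (P S f) = P S (s.BV S f) :=
        (congrArg (fun C => C f) (s.BV_comm S (P S) (fun i _ => hPA S i)).eq).symm
      have a2 : P S (s.E S (s.BV S f)) = s.E S (P S (s.BV S f)) :=
        (congrArg (fun C => C (s.BV S f)) (hPE S S).eq)
      rw [a1, a2, map_sub]; abel
    have h1 := norm_add_le (P S (s.E S (s.BV S f))) (s.E S (P S f - s.BV S (P S f)))
    rw [← e] at h1
    have h2 := hP S (s.E S (s.BV S f))
    have h3 := s.E_one_sub S (P S f)
    rw [S.2] at h3
    push_cast at h3
    calc _ ≤ (‖s.E S (s.BV S f)‖ + (j + 1) * s.η * ‖P S f‖) ^ 2 := by gcongr; linarith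
      _ ≤ _ := by nlinarith [sq_nonneg (‖s.E S (s.BV S f)‖ - (j + 1) * s.η * ‖P S f‖)]
  refine (Finset.sum_le_sum fun S _ => h S).trans ?_
  rw [Finset.sum_add_distrib, ← Finset.mul_sum, ← Finset.mul_sum, hΦ]
  have := hPs f
  gcongr
end AS
end layer1
end KS
namespace KS
open scoped InnerProductSpace

section local_bounds
variable {V : Type*} [NormedAddCommGroup V] [InnerProductSpace ℂ V]

lemma local_bounds (A Q O Os R E : Module.End ℂ V) (a b : ℝ) (ha : 0 ≤ a) (hb : 0 ≤ b)
    (hA : A * A = A) (hAs : ∀ f g, ⟪A f, g⟫_ℂ = ⟪f, A g⟫_ℂ)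
    (hQA : Commute Q A) (hOsA : Commute Os A)
    (hO : ∀ f, ‖O f‖ = ‖f‖) (hOs : ∀ f, ‖Os f‖ = ‖f‖)
    (hOE : Commute O E) (hOsE : Commute Os E)
    (hOR : Commute O R) (hOsR : Commute Os R) (hRQ : R * Q = R)
    (hD : (O - Os) * Q = (O - Os) * R)
    (hRs : ∀ f g, ⟪R f, g⟫_ℂ = ⟪f, R g⟫_ℂ)
    (hRA : ∀ f, ‖R (A f)‖ ≤ a * ‖A f‖)
    (hEA : ∀ f, ‖E (A f)‖ ≤ b * ‖A f‖)
    (hERA : ∀ f, ‖E (R (A f))‖ ≤ a * b * ‖A f‖)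
    (φ : V) (hφ : Q φ = φ) :
    ‖(1 - A) (O φ)‖ ≤ ‖(1 - A) φ‖ + 2 * a * ‖φ‖ ∧
    ‖E ((1 - A) (O φ))‖ ≤ ‖E ((1 - A) φ)‖ + 6 * (a * b) * ‖φ‖ := by
  have hAle := proj_le A hA hAs
  have hBle : ∀ f, ‖(1 - A) f‖ ≤ ‖f‖ := fun f => by simpa using proj_compl_le A hA hAs f
  have app : ∀ {C D : Module.End ℂ V}, C = D → ∀ f, C f = D f := fun h f => by rw [h]
  have hDle : ∀ f, ‖(O - Os) f‖ ≤ 2 * ‖f‖ := fun f => by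
    have := norm_sub_le (O f) (Os f)
    rw [hO, hOs] at this
    simp only [LinearMap.sub_apply]; linarith
  have hAA : ∀ f, A (A f) = A f := fun f => app hA f
  have hQA' : ∀ f, Q (A f) = A (Q f) := fun f => app hQA.eq f
  have hOsA' : ∀ f, Os (A f) = A (Os f) := fun f => app hOsA.eq f
  have hD' : ∀ f, (O - Os) (Q f) = (O - Os) (R f) := fun f => app hD f
  have hDE : ∀ f, (O - Os) (E f) = E ((O - Os) f) := fun f => app (hOE.sub_left hOsE).eq f
  have hDR : ∀ f, (O - Os) (R f) = R ((O - Os) f) := fun f => app (hOR.sub_left hOsR).eq f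
  have hRQ' : ∀ f, R (Q f) = R f := fun f => app hRQ f
  -- the vector Δ A φ
  have e1 : (O - Os) (A φ) = (O - Os) (R (A φ)) := by
    rw [← hD', hQA', hφ]
  have n1 : ‖(O - Os) (A φ)‖ ≤ 2 * a * ‖φ‖ := by
    rw [e1]
    have h1 := hDle (R (A φ))
    have h2 := hRA φ
    have h3 := mul_le_mul_of_nonneg_left (hAle φ) ha
    linarith
  have e2 : (1 - A) (O (A φ)) = (1 - A) ((O - Os) (A φ)) := by
    simp [hOsA', hAA]
  -- (b)
  have hb' : ‖A (O ((1 - A) φ))‖ ≤ 2 * a * ‖φ‖ := by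
    have e3 : A (O ((1 - A) φ)) = A ((O - Os) ((1 - A) φ)) := by
      simp [hOsA', hAA]
    rw [e3]
    set h := (O - Os) ((1 - A) φ) with hh
    have hq : Q ((1 - A) φ) = (1 - A) φ := by simp [hQA', hφ]
    have hRh : R h = h := by
      rw [hh, ← hDR, ← hRQ', ← hq, hq, hRQ', ← hD', hq]
    have hn : ‖h‖ ≤ 2 * ‖φ‖ := by
      have := hDle ((1 - A) φ); have := hBle φ; linarith
    have key : ‖A h‖ * ‖A h‖ ≤ a * ‖A h‖ * ‖h‖ := by
      have i1 : ⟪A h, A h⟫_ℂ = ⟪R (A h), h⟫_ℂ := by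
        rw [hRs, hRh, ← hAs (A h) h, hAA]
      have i2 : ‖⟪A h, A h⟫_ℂ‖ = ‖A h‖ * ‖A h‖ := by
        rw [inner_self_eq_norm_sq_to_K]; simp [sq]
      rw [← i2, i1]
      refine (norm_inner_le_norm _ _).trans ?_
      gcongr
      exact hRA h
    by_cases h0 : ‖A h‖ = 0
    · rw [h0]; positivity
    · have hp : 0 < ‖A h‖ := lt_of_le_of_ne (norm_nonneg _) (Ne.symm h0)
      have : ‖A h‖ ≤ a * ‖h‖ := by
        by_contra hc
        push Not at hc
        nlinarith
      have := mul_le_mul_of_nonneg_left hn ha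
      linarith
  have split : O φ = O (A φ) + O ((1 - A) φ) := by rw [← map_add]; simp
  constructor
  · rw [split, map_add, add_comm]
    refine (norm_add_le _ _).trans ?_
    have h1 := hBle (O ((1 - A) φ))
    rw [hO] at h1
    rw [e2]
    have h2 := hBle ((O - Os) (A φ))
    linarith
  · have e4 : E ((1 - A) (O φ)) = O (E ((1 - A) φ)) + (E ((O - Os) (A φ)) -
        E (A ((O - Os) (A φ))) - E (A (O ((1 - A) φ)))) := by
      have : (1 - A) (O φ) = O ((1 - A) φ) + ((O - Os) (A φ) - A ((O - Os) (A φ))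
          - A (O ((1 - A) φ))) := by
        conv_lhs => rw [split, map_add, e2]
        simp only [LinearMap.sub_apply, Module.End.one_apply]
        abel
      rw [this, map_add, map_sub, map_sub, show O (E ((1 - A) φ)) = E (O ((1 - A) φ)) from
        app hOE.eq _]
    rw [e4]
    refine (norm_add_le _ _).trans ?_
    rw [hO]
    have t1 : ‖E ((O - Os) (A φ))‖ ≤ 2 * (a * b) * ‖φ‖ := by
      rw [e1, ← hDE]
      have h1 := hDle (E (R (A φ)))
      have h2 := hERA φ
      have h3 := mul_le_mul_of_nonneg_left (hAle φ) (mul_nonneg ha hb)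
      linarith
    have t2 : ‖E (A ((O - Os) (A φ)))‖ ≤ 2 * (a * b) * ‖φ‖ := by
      have h1 := hEA ((O - Os) (A φ))
      have h2 := (hAle ((O - Os) (A φ))).trans n1
      have h3 := mul_le_mul_of_nonneg_left h2 hb
      linarith
    have t3 : ‖E (A (O ((1 - A) φ)))‖ ≤ 2 * (a * b) * ‖φ‖ := by
      have h1 := hEA (O ((1 - A) φ))
      have h3 := mul_le_mul_of_nonneg_left hb' hb
      linarith
    have := norm_sub_le (E ((O - Os) (A φ)) - E (A ((O - Os) (A φ)))) (E (A (O ((1 - A) φ))))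
    have := norm_sub_le (E ((O - Os) (A φ))) (E (A ((O - Os) (A φ))))
    linarith
end local_bounds

section diagmore
variable {ι X H : Type*} [Fintype ι] [DecidableEq ι] [Fintype X]
  [NormedAddCommGroup H] [InnerProductSpace ℂ H]

lemma diagOp_iso (G : (ι → X) → Module.End ℂ H) (hG : ∀ x v, ‖G x v‖ = ‖v‖) (f : Sp ι X H) :
    ‖diagOp G f‖ = ‖f‖ := by
  rw [← sq_eq_sq₀ (norm_nonneg _) (norm_nonneg _), normsq, normsq]
  simp [diagOp_apply, hG]

lemma diagOp_le (G : (ι → X) → Module.End ℂ H) (hG : ∀ x v, ‖G x v‖ ≤ ‖v‖) (f : Sp ι X H) :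
    ‖diagOp G f‖ ≤ ‖f‖ := by
  rw [← sq_le_sq₀ (norm_nonneg _) (norm_nonneg _), normsq, normsq]
  refine Finset.sum_le_sum fun x _ => ?_
  have := hG x (f x)
  rw [diagOp_apply]
  gcongr

lemma diagOp_commute (G G' : (ι → X) → Module.End ℂ H) (h : ∀ x, Commute (G x) (G' x)) :
    Commute (diagOp G) (diagOp G') := by
  unfold Commute SemiconjBy
  rw [diagOp_mul, diagOp_mul]
  congr 1; ext1 x; exact (h x).eq

lemma diagOp_sa (G : (ι → X) → Module.End ℂ H) (hG : ∀ x u v, ⟪G x u, v⟫_ℂ = ⟪u, G x v⟫_ℂ)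
    (f g : Sp ι X H) : ⟪diagOp G f, g⟫_ℂ = ⟪f, diagOp G g⟫_ℂ := by
  simp [PiLp.inner_apply, diagOp_apply, hG]

lemma diagOp_sub (G G' : (ι → X) → Module.End ℂ H) :
    diagOp G - diagOp G' = diagOp (fun x => G x - G' x) := by
  ext f x; simp [diagOp_apply]

lemma avg_le [Nonempty X] (i : ι) (f : Sp ι X H) : ‖avgOp i f‖ ≤ ‖f‖ := by
  have h := proj_le (V := Sp ι X H) (avgOp i) (avg_idem i) (fun f g => avg_sa i f g)
  exact h f

lemma avg_compl_le [Nonempty X] (i : ι) (f : Sp ι X H) : ‖f - avgOp i f‖ ≤ ‖f‖ := by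
  have h := proj_compl_le (V := Sp ι X H) (avgOp i) (avg_idem i) (fun f g => avg_sa i f g)
  exact h f
end diagmore

section conc
variable {M : ℕ} [NeZero M] {J W : Type} [Fintype J] [Fintype W]
open Classical in
def mask (P : Option J → Prop) : Module.End ℂ (QSpace M J W) where
  toFun v := WithLp.toLp 2 (fun p => if P p.2.1 then v p else 0)
  map_add' f g := by ext p; by_cases h : P p.2.1 <;> simp [h]
  map_smul' c f := by ext p; by_cases h : P p.2.1 <;> simp [h]

open Classical in
lemma mask_apply (P : Option J → Prop) (v : QSpace M J W) (p : QIdx M J W) :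
    mask P v p = if P p.2.1 then v p else 0 := rfl

def oL (z : J → ZMod M) : Module.End ℂ (QSpace M J W) :=
  ((oracle M z : QSpace M J W ≃ₗᵢ[ℂ] QSpace M J W).toLinearEquiv : _ →ₗ[ℂ] _)

lemma oL_eq (z : J → ZMod M) (v : QSpace M J W) : oL z v = oracle M z v := rfl

lemma oL_apply (z : J → ZMod M) (v : QSpace M J W) (p : QIdx M J W) :
    oL z v p = v (p.1 - p.2.1.elim 0 z, p.2) := rfl

lemma oL_norm (z : J → ZMod M) (v : QSpace M J W) : ‖oL z v‖ = ‖v‖ := by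
  rw [oL_eq]; exact LinearIsometryEquiv.norm_map _ _

lemma mask_oL (P : Option J → Prop) (z : J → ZMod M) :
    Commute (mask P : Module.End ℂ (QSpace M J W)) (oL z) := by
  ext1 v; ext p
  simp only [Module.End.mul_apply, mask_apply, oL_apply]

lemma mask_sa (P : Option J → Prop) (u v : QSpace M J W) :
    ⟪mask P u, v⟫_ℂ = ⟪u, mask P v⟫_ℂ := by
  simp only [PiLp.inner_apply, mask_apply]
  refine Finset.sum_congr rfl fun p _ => ?_
  split_ifs <;> simp

lemma mask_mul (P P' : Option J → Prop) :
    (mask P * mask P' : Module.End ℂ (QSpace M J W)) = mask (fun o => P o ∧ P' o) := by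
  ext1 v; ext p
  simp only [Module.End.mul_apply, mask_apply]
  by_cases h : P p.2.1 <;> by_cases h' : P' p.2.1 <;> simp [h, h']

lemma mask_sum {κ : Type*} [Fintype κ] (c : Option J → κ) (v : QSpace M J W) :
    ∑ o, ‖mask (fun j => c j = o) v‖ ^ 2 = ‖v‖ ^ 2 := by
  classical
  simp only [EuclideanSpace.norm_sq_eq, mask_apply]
  rw [Finset.sum_comm]
  refine Finset.sum_congr rfl fun p _ => ?_
  rw [Finset.sum_eq_single (c p.2.1)]
  · simp
  · intro b _ hb; simp [hb.symm]
  · simp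

lemma mask_sum_le {κ : Type*} [Fintype κ] (P : κ → Option J → Prop)
    (hP : ∀ a b j, P a j → P b j → a = b) (v : QSpace M J W) :
    ∑ o, ‖mask (P o) v‖ ^ 2 ≤ ‖v‖ ^ 2 := by
  classical
  simp only [EuclideanSpace.norm_sq_eq, mask_apply]
  rw [Finset.sum_comm]
  refine Finset.sum_le_sum fun p _ => ?_
  by_cases h : ∃ a, P a p.2.1
  · obtain ⟨a, ha⟩ := h
    rw [Finset.sum_eq_single a]
    · simp [ha]
    · intro b _ hb
      have : ¬ P b p.2.1 := fun h => hb (hP _ _ _ h ha)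
      simp [this]
    · simp
  · push Not at h
    simp [h]
end conc

section inst
variable (n ℓ m : ℕ) [NeZero m] (W : Type) [Fintype W]

abbrev XX := Fin ℓ × ZMod m
abbrev HH := QSpace (m + 1) (Fin n × Fin ℓ) W
abbrev VV := Sp (Fin n) (XX ℓ m) (HH n ℓ m W)

def enc (x : Fin n → XX ℓ m) : Fin n × Fin ℓ → ZMod (m + 1) :=
  encode n ℓ m (fun i => (x i).2) (fun i => (x i).1)

lemma enc_apply (x : Fin n → XX ℓ m) (i : Fin n) (j : Fin ℓ) :
    enc n ℓ m x (i, j) = if j = (x i).1 then (((x i).2).val : ZMod (m + 1)) else (m : ZMod (m+1)) :=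
  rfl

def Qop (o : Option (Fin n)) : Module.End ℂ (VV n ℓ m W) :=
  diagOp (fun _ => mask (fun j => j.map Prod.fst = o))
def Oop : Module.End ℂ (VV n ℓ m W) := diagOp (fun x => oL (enc n ℓ m x))
def Osop : Module.End ℂ (VV n ℓ m W) := diagOp (fun _ => oL (fun _ => (m : ZMod (m + 1))))
def Rop (i : Fin n) : Module.End ℂ (VV n ℓ m W) :=
  diagOp (fun x => mask (fun j => j = some (i, (x i).1)))
def Eop (w : ZMod m) (S : Finset (Fin n)) : Module.End ℂ (VV n ℓ m W) :=
  diagOp (fun x => if ∑ i ∈ S, (x i).2 = w then 1 else 0)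

lemma ite_comm {V : Type*} [AddCommGroup V] [Module ℂ V] (p : Prop) [Decidable p]
    (C : Module.End ℂ V) : Commute C (if p then 1 else 0) := by
  split_ifs
  · exact Commute.one_right _
  · exact Commute.zero_right _

lemma Δ_eq (i : Fin n) : (Oop n ℓ m W - Osop n ℓ m W) * Qop n ℓ m W (some i)
    = (Oop n ℓ m W - Osop n ℓ m W) * Rop n ℓ m W i := by
  unfold Oop Osop Qop Rop
  rw [diagOp_sub, diagOp_mul, diagOp_mul]
  congr 1; ext1 x; ext1 v; ext ⟨a, j, c⟩
  simp only [Module.End.mul_apply, LinearMap.sub_apply, PiLp.sub_apply, oL_apply, mask_apply]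
  rcases j with _ | ⟨i', j⟩
  · simp
  · by_cases hi : i' = i
    · subst hi
      by_cases hj : j = (x i').1
      · simp [enc_apply, hj]
      · simp [enc_apply, hj]
    · simp [hi]

lemma OA (o : Option (Fin n)) (i : Fin n) (h : o ≠ some i) :
    Commute (Oop n ℓ m W * Qop n ℓ m W o) (avgOp i) := by
  unfold Oop Qop
  rw [diagOp_mul]
  refine diag_avg_comm _ _ ?_
  intro x y
  ext1 v; ext ⟨a, j, c⟩
  simp only [Module.End.mul_apply, oL_apply, mask_apply]
  rcases j with _ | ⟨i', j⟩
  · simp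
  · by_cases hi : i' = i
    · subst hi
      simp [h.symm]
    · simp [enc_apply, hi]

lemma ite_norm {V : Type*} [NormedAddCommGroup V] [Module ℂ V] (p : Prop) [Decidable p] (v : V) :
    ‖(if p then (1 : Module.End ℂ V) else 0) v‖ ^ 2 = if p then ‖v‖ ^ 2 else 0 := by
  split_ifs <;> simp

lemma sum_upd (S : Finset (Fin n)) (i : Fin n) (hi : i ∈ S) (x : Fin n → XX ℓ m) (y : XX ℓ m)
    (w : ZMod m) :
    (∑ a ∈ S, (Function.update x i y a).2 = w) ↔ y.2 = w - ∑ a ∈ S.erase i, (x a).2 := by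
  rw [← Finset.add_sum_erase S _ hi, eq_sub_iff_add_eq]
  have : ∑ a ∈ S.erase i, (Function.update x i y a).2 = ∑ a ∈ S.erase i, (x a).2 :=
    Finset.sum_congr rfl fun a ha => by
      rw [Function.update_of_ne (Finset.ne_of_mem_erase ha)]
  rw [this]; simp

variable [NeZero ℓ]

lemma RA_bd (i : Fin n) (f : VV n ℓ m W) :
    ‖Rop n ℓ m W i (avgOp i f)‖ ≤ (1 / √ℓ) * ‖avgOp i f‖ := by
  have hl : (ℓ : ℝ) ≠ 0 := by exact_mod_cast NeZero.ne ℓ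
  refine norm_diag_avg i _ _ ?_ (by positivity) f
  intro x v
  simp only [Function.update_self]
  rw [Fintype.sum_prod_type]
  simp only [Finset.sum_const, Finset.card_univ, ZMod.card, nsmul_eq_mul, Fintype.card_prod,
    Fintype.card_fin]
  rw [← Finset.mul_sum]
  have := mask_sum_le (M := m + 1) (W := W) (fun (r : Fin ℓ) (j : Option (Fin n × Fin ℓ)) =>
    j = some (i, r)) (by rintro a b j rfl h; simpa using h) v
  rw [div_pow, Real.sq_sqrt (by positivity)]
  push_cast
  field_simp
  exact mul_le_mul_of_nonneg_left this (by positivity)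

lemma EA_bd (w : ZMod m) (S : Finset (Fin n)) (i : Fin n) (hi : i ∈ S) (f : VV n ℓ m W) :
    ‖Eop n ℓ m W w S (avgOp i f)‖ ≤ (1 / √m) * ‖avgOp i f‖ := by
  have hl : (m : ℝ) ≠ 0 := by exact_mod_cast NeZero.ne m
  refine norm_diag_avg i _ _ ?_ (by positivity) f
  intro x v
  simp only [ite_norm, sum_upd n ℓ m S i hi]
  rw [Fintype.sum_prod_type]
  simp only [Finset.sum_ite_eq', Finset.mem_univ, if_true, Finset.sum_const, Finset.card_univ,
    ZMod.card, nsmul_eq_mul, Fintype.card_prod, Fintype.card_fin]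
  rw [div_pow, Real.sq_sqrt (by positivity)]
  push_cast
  apply le_of_eq
  field_simp

lemma ERA_bd (w : ZMod m) (S : Finset (Fin n)) (i : Fin n) (hi : i ∈ S) (f : VV n ℓ m W) :
    ‖Eop n ℓ m W w S (Rop n ℓ m W i (avgOp i f))‖ ≤ (1 / √ℓ) * (1 / √m) * ‖avgOp i f‖ := by
  have hl : (ℓ : ℝ) ≠ 0 := by exact_mod_cast NeZero.ne ℓ
  have hm : (m : ℝ) ≠ 0 := by exact_mod_cast NeZero.ne m
  rw [← Module.End.mul_apply, Eop, Rop, diagOp_mul]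
  refine norm_diag_avg i _ _ ?_ (by positivity) f
  intro x v
  simp only [Module.End.mul_apply, ite_norm, sum_upd n ℓ m S i hi, Function.update_self]
  rw [Fintype.sum_prod_type]
  simp only [Finset.sum_ite_eq', Finset.mem_univ, if_true, Fintype.card_prod, Fintype.card_fin,
    ZMod.card]
  have := mask_sum_le (M := m + 1) (W := W) (fun (r : Fin ℓ) (j : Option (Fin n × Fin ℓ)) =>
    j = some (i, r)) (by rintro a b j rfl h; simpa using h) v
  rw [mul_pow, div_pow, div_pow, Real.sq_sqrt (by positivity), Real.sq_sqrt (by positivity)]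
  push_cast
  field_simp
  exact this

lemma E_le (w : ZMod m) (S : Finset (Fin n)) (f : VV n ℓ m W) :
    ‖Eop n ℓ m W w S f‖ ≤ ‖f‖ := by
  refine diagOp_le _ ?_ f
  intro x v
  split_ifs <;> simp

lemma loc (w : ZMod m) (S : Finset (Fin n)) (i : Fin n) (hi : i ∈ S) (φ : VV n ℓ m W)
    (hφ : Qop n ℓ m W (some i) φ = φ) :
    ‖(1 - avgOp i : Module.End ℂ (VV n ℓ m W)) (Oop n ℓ m W φ)‖
      ≤ ‖(1 - avgOp i : Module.End ℂ (VV n ℓ m W)) φ‖ + 2 * (1 / √ℓ) * ‖φ‖ ∧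
    ‖Eop n ℓ m W w S ((1 - avgOp i : Module.End ℂ (VV n ℓ m W)) (Oop n ℓ m W φ))‖
      ≤ ‖Eop n ℓ m W w S ((1 - avgOp i : Module.End ℂ (VV n ℓ m W)) φ)‖
        + 6 * ((1 / √ℓ) * (1 / √m)) * ‖φ‖ := by
  refine local_bounds (avgOp i) (Qop n ℓ m W (some i)) (Oop n ℓ m W) (Osop n ℓ m W)
    (Rop n ℓ m W i) (Eop n ℓ m W w S) (1 / √ℓ) (1 / √m) (by positivity) (by positivity)
    (avg_idem i) (avg_sa i) (diag_avg_comm _ _ fun _ _ => rfl) (diag_avg_comm _ _ fun _ _ => rfl)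
    (diagOp_iso _ fun _ _ => oL_norm _ _) (diagOp_iso _ fun _ _ => oL_norm _ _)
    (diagOp_commute _ _ fun _ => ite_comm _ _) (diagOp_commute _ _ fun _ => ite_comm _ _)
    (diagOp_commute _ _ fun _ => (mask_oL _ _).symm)
    (diagOp_commute _ _ fun _ => (mask_oL _ _).symm) ?_ (Δ_eq n ℓ m W i)
    (diagOp_sa _ fun _ => mask_sa _) (RA_bd n ℓ m W i)
    (EA_bd n ℓ m W w S i hi) (ERA_bd n ℓ m W w S i hi) φ hφ
  unfold Rop Qop
  rw [diagOp_mul]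
  congr 1; ext1 x
  rw [mask_mul]
  congr 1; ext1 j
  refine propext ⟨fun h => h.1, fun h => ⟨h, by rw [h]; rfl⟩⟩

def theAS (w : ZMod m) : AS (Fin n) (VV n ℓ m W) where
  A := avgOp
  Q := Qop n ℓ m W
  O := Oop n ℓ m W
  E := Eop n ℓ m W w
  δ := 2 * (1 / √ℓ)
  ε := 6 * ((1 / √ℓ) * (1 / √m))
  η := 1 / √m
  hδ := by positivity
  hδ2 := by
    have : (1 : ℝ) ≤ ℓ := by exact_mod_cast NeZero.one_le
    have : 1 / √(ℓ : ℝ) ≤ 1 := by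
      rw [div_le_one (by positivity)]
      exact Real.one_le_sqrt.2 this
    linarith
  hε := by positivity
  hη := by positivity
  hAidem := avg_idem
  hAle := avg_le
  hBle := avg_compl_le
  hAA := avg_comm
  hQA o i := diag_avg_comm _ _ fun _ _ => rfl
  hQO o := diagOp_commute _ _ fun _ => mask_oL _ _
  hQE o S := diagOp_commute _ _ fun _ => ite_comm _ _
  hQidem o := by
    unfold Qop
    rw [diagOp_mul]
    congr 1; ext1 x
    rw [mask_mul]; simp
  hQsum f := by
    simp only [normsq]
    rw [Finset.sum_comm]
    refine Finset.sum_congr rfl fun x _ => ?_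
    exact mask_sum (M := m + 1) (W := W) (fun j : Option (Fin n × Fin ℓ) => j.map Prod.fst) (f x)
  hOA := OA n ℓ m W
  hO := diagOp_iso _ fun _ _ => oL_norm _ _
  hOE S := diagOp_commute _ _ fun _ => ite_comm _ _
  h1 i φ hφ := (loc n ℓ m W w {i} i (by simp) φ hφ).1
  h2 i S hi φ hφ := (loc n ℓ m W w S i hi φ hφ).2
  h3 i S hi φ := (EA_bd n ℓ m W w S i hi φ).trans
    (mul_le_mul_of_nonneg_left (avg_le i φ) (by positivity))
end inst
end KS

namespace KS
open scoped InnerProductSpace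

section meas
variable {H κ : Type*} [NormedAddCommGroup H] [InnerProductSpace ℂ H] [CompleteSpace H] [Fintype κ]

lemma meas_sum (P : Option κ → H →L[ℂ] H) (hsa : ∀ o, IsSelfAdjoint (P o))
    (hidem : ∀ o, (P o).comp (P o) = P o) (hsum : ∑ o, P o = 1) (v : H) :
    ∑ S, ‖P (some S) v‖ ^ 2 ≤ ‖v‖ ^ 2 := by
  have h : ∀ o, ‖P o v‖ ^ 2 = RCLike.re ⟪P o v, v⟫_ℂ := by
    intro o
    have hs := (ContinuousLinearMap.isSelfAdjoint_iff_isSymmetric.1 (hsa o))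
    have hp : P o (P o v) = P o v := by
      rw [← ContinuousLinearMap.comp_apply, hidem]
    have : ⟪P o v, P o v⟫_ℂ = ⟪P o v, v⟫_ℂ := by
      have := hs (P o v) v
      simp only [ContinuousLinearMap.coe_coe] at this
      rw [← this, hp]
    rw [← this, inner_self_eq_norm_sq]
  have h2 : ∑ o, ‖P o v‖ ^ 2 = ‖v‖ ^ 2 := by
    simp only [h]
    rw [← map_sum, ← sum_inner, ← sum_apply, hsum]
    exact inner_self_eq_norm_sq v
  rw [Fintype.sum_option] at h2
  have : 0 ≤ ‖P none v‖ ^ 2 := by positivity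
  linarith

lemma meas_le (P : Option κ → H →L[ℂ] H) (hsa : ∀ o, IsSelfAdjoint (P o))
    (hidem : ∀ o, (P o).comp (P o) = P o) (hsum : ∑ o, P o = 1) (S : κ) (v : H) :
    ‖P (some S) v‖ ≤ ‖v‖ := by
  have := meas_sum P hsa hidem hsum v
  have h2 := Finset.single_le_sum (f := fun S => ‖P (some S) v‖ ^ 2)
    (fun _ _ => by positivity) (Finset.mem_univ S)
  exact (sq_le_sq₀ (norm_nonneg _) (norm_nonneg _)).1 (h2.trans this)
end meas

section prob
variable (n ℓ m j : ℕ) [NeZero m] [NeZero ℓ] (W : Type) [Fintype W]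

lemma prob_bound (w : ZMod m) (T : ℕ) (U : ℕ → HH n ℓ m W ≃ₗᵢ[ℂ] HH n ℓ m W)
    (ψ0 : HH n ℓ m W) (hψ0 : ‖ψ0‖ = 1)
    (P : Option {S : Finset (Fin n) // S.card = j + 1} → HH n ℓ m W →L[ℂ] HH n ℓ m W)
    (hsa : ∀ o, IsSelfAdjoint (P o))
    (hidem : ∀ o, (P o).comp (P o) = P o) (hsum : ∑ o, P o = 1) :
    ∑ x : Fin n → XX ℓ m, ∑ S : {S : Finset (Fin n) // S.card = j + 1},
      (if ∑ i ∈ S.val, (x i).2 = w then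
        ‖P (some S) (stateAfter (m + 1) (Fin n × Fin ℓ) W U (oracle (m + 1) (enc n ℓ m x)) ψ0 T)‖ ^ 2
        else 0) ≤
      ((ℓ : ℝ) * m) ^ n * ((72 * 8 ^ j * (T / √ℓ) ^ (j + 2) + 2 * (j + 1) ^ 2) / m) := by
  have hl : (0 : ℝ) < ℓ := by exact_mod_cast NeZero.pos ℓ
  have hm : (0 : ℝ) < m := by exact_mod_cast NeZero.pos m
  let s := theAS n ℓ m W w
  let ψ : ℕ → VV n ℓ m W := fun t => WithLp.toLp 2 (fun x =>
    stateAfter (m + 1) (Fin n × Fin ℓ) W U (oracle (m + 1) (enc n ℓ m x)) ψ0 t)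
  let Uop : ℕ → Module.End ℂ (VV n ℓ m W) := fun t =>
    diagOp (fun _ => ((U t).toLinearEquiv : HH n ℓ m W →ₗ[ℂ] HH n ℓ m W))
  let Pop : {S : Finset (Fin n) // S.card = j + 1} → Module.End ℂ (VV n ℓ m W) := fun S =>
    diagOp (fun _ => (P (some S) : HH n ℓ m W →ₗ[ℂ] HH n ℓ m W))
  have hψn : ‖ψ 0‖ ^ 2 = ((ℓ : ℝ) * m) ^ n := by
    rw [normsq]
    simp [ψ, stateAfter, hψ0]
  obtain ⟨h1, h2, h3⟩ := s.evolve Uop ψ (fun t => rfl)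
    (fun t => diagOp_iso _ fun _ v => (U t).norm_map v)
    (fun t i => diag_avg_comm _ _ fun _ _ => rfl)
    (fun t S => diagOp_commute _ _ fun _ => ite_comm _ _)
    (by
      intro i
      ext1 x
      change avgOp i (ψ 0) x = _
      rw [avgOp_apply]
      simp only [ψ, stateAfter]
      rw [Finset.sum_const, ← Nat.cast_smul_eq_nsmul ℂ, smul_smul, Finset.card_univ,
        inv_mul_cancel₀ (by exact_mod_cast Fintype.card_ne_zero), one_smul])
  have h4 := s.success j Pop (fun S i => diag_avg_comm _ _ fun _ _ => rfl)
    (fun S S' => diagOp_commute _ _ fun _ => ite_comm _ _)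
    (fun S => diagOp_le _ fun _ v => meas_le P hsa hidem hsum S v)
    (by
      intro f
      simp only [normsq]
      rw [Finset.sum_comm]
      refine Finset.sum_le_sum fun x _ => ?_
      exact meas_sum P hsa hidem hsum (f x)) (ψ T)
  have h5 : ∑ x : Fin n → XX ℓ m, ∑ S : {S : Finset (Fin n) // S.card = j + 1},
      (if ∑ i ∈ S.val, (x i).2 = w then
        ‖P (some S) (stateAfter (m + 1) (Fin n × Fin ℓ) W U
          (oracle (m + 1) (enc n ℓ m x)) ψ0 T)‖ ^ 2 else 0)
      = ∑ S : {S : Finset (Fin n) // S.card = j + 1}, ‖s.E S (Pop S (ψ T))‖ ^ 2 := by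
    simp only [normsq]
    rw [Finset.sum_comm]
    refine Finset.sum_congr rfl fun S _ => Finset.sum_congr rfl fun x _ => ?_
    exact (ite_norm _ _).symm
  rw [h5]
  refine h4.trans ?_
  have hδ : s.δ = 2 * (1 / √ℓ) := rfl
  have hε : s.ε = 6 * ((1 / √ℓ) * (1 / √m)) := rfl
  have hη : s.η = 1 / √m := rfl
  have hΦ := h3 j T
  rw [hδ, hε, Real.sqrt_le_left (by positivity), mul_pow, Real.sq_sqrt (by positivity), hψn] at hΦ
  rw [h1 T, hψn, hη]
  have hsm : (√(m : ℝ)) ^ 2 = m := Real.sq_sqrt hm.le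
  have e1 : (T * (6 * (1 / √ℓ * (1 / √m)))) ^ 2 * ((4 * (2 * (1 / √ℓ)) * T) ^ j * ((ℓ : ℝ) * m) ^ n)
      = ((ℓ : ℝ) * m) ^ n * (36 * 8 ^ j * (T / √ℓ) ^ (j + 2)) / m := by
    have : (T * (6 * (1 / √ℓ * (1 / √m)))) ^ 2 = 36 * (T / √ℓ) ^ 2 / (m : ℝ) := by
      rw [show (T * (6 * (1 / √ℓ * (1 / √m)))) ^ 2 = 36 * (T / √ℓ) ^ 2 / (√(m : ℝ)) ^ 2 by ring, hsm]
    rw [this, show (4 * (2 * (1 / √ℓ)) * T : ℝ) = 8 * (T / √ℓ) by ring, mul_pow]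
    ring
  have e2 : ((j + 1) * (1 / √m)) ^ 2 = ((j : ℝ) + 1) ^ 2 / m := by
    rw [mul_pow, div_pow, hsm]; ring
  rw [e2]
  rw [e1] at hΦ
  calc _ ≤ 2 * (((ℓ : ℝ) * m) ^ n * (36 * 8 ^ j * (T / √ℓ) ^ (j + 2)) / m)
        + 2 * (((j : ℝ) + 1) ^ 2 / m) * ((ℓ : ℝ) * m) ^ n := by gcongr
    _ = _ := by ring
end prob

section count
variable {n m : ℕ} [NeZero m]

lemma count1 (w : ZMod m) (S : Finset (Fin n)) (hS : S.Nonempty) :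
    (Finset.univ.filter fun t : Fin n → ZMod m => ∑ i ∈ S, t i = w).card * m ≤ m ^ n := by
  obtain ⟨i, hi⟩ := hS
  have : (Finset.univ.filter fun t : Fin n → ZMod m => ∑ i ∈ S, t i = w).card * m
      = ((Finset.univ.filter fun t : Fin n → ZMod m => ∑ i ∈ S, t i = w) ×ˢ
        (Finset.univ : Finset (ZMod m))).card := by
    rw [Finset.card_product, Finset.card_univ, ZMod.card]
  rw [this]
  have h2 : m ^ n = (Finset.univ : Finset (Fin n → ZMod m)).card := by
    simp [ZMod.card]
  rw [h2]
  refine Finset.card_le_card_of_injOn (fun p => p.1 + Pi.single i p.2) (fun _ _ => by simp) ?_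
  rintro ⟨t, a⟩ h ⟨t', a'⟩ h' he
  simp only [Finset.coe_product, Set.mem_prod, Finset.mem_coe, Finset.mem_filter,
    Finset.mem_univ, true_and, and_true] at h h' he
  have hs := congrArg (fun t : Fin n → ZMod m => ∑ i ∈ S, t i) he
  simp only [Pi.add_apply, Finset.sum_add_distrib, h, h', Pi.single_apply, Finset.sum_ite_eq', hi, if_true] at hs
  have : a = a' := by simpa using hs
  subst this
  simpa using he

lemma count2 (w : ZMod m) (S S' : Finset (Fin n)) (hne : S ≠ S') (hc : S.card = S'.card) :
    (Finset.univ.filter fun t : Fin n → ZMod m =>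
      ∑ i ∈ S, t i = w ∧ ∑ i ∈ S', t i = w).card * m ^ 2 ≤ m ^ n := by
  obtain ⟨i, hi, hi'⟩ : ∃ i ∈ S, i ∉ S' := by
    by_contra h
    push Not at h
    exact hne (Finset.eq_of_subset_of_card_le h hc.ge)
  obtain ⟨l, hl, hl'⟩ : ∃ i ∈ S', i ∉ S := by
    by_contra h
    push Not at h
    exact hne (Finset.eq_of_subset_of_card_le h hc.le).symm
  have : (Finset.univ.filter fun t : Fin n → ZMod m =>
      ∑ i ∈ S, t i = w ∧ ∑ i ∈ S', t i = w).card * m ^ 2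
      = ((Finset.univ.filter fun t : Fin n → ZMod m =>
      ∑ i ∈ S, t i = w ∧ ∑ i ∈ S', t i = w) ×ˢ
        (Finset.univ : Finset (ZMod m × ZMod m))).card := by
    rw [Finset.card_product, Finset.card_univ, Fintype.card_prod, ZMod.card, sq]
  rw [this]
  have h2 : m ^ n = (Finset.univ : Finset (Fin n → ZMod m)).card := by
    simp [ZMod.card]
  rw [h2]
  refine Finset.card_le_card_of_injOn (fun p => p.1 + Pi.single i p.2.1 + Pi.single l p.2.2)
    (fun _ _ => by simp) ?_
  rintro ⟨t, a, b⟩ h ⟨t', a', b'⟩ h' he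
  simp only [Finset.coe_product, Set.mem_prod, Finset.mem_coe, Finset.mem_filter,
    Finset.mem_univ, true_and, and_true] at h h' he
  have hs := congrArg (fun t : Fin n → ZMod m => ∑ i ∈ S, t i) he
  have hs' := congrArg (fun t : Fin n → ZMod m => ∑ i ∈ S', t i) he
  simp only [Pi.add_apply, Finset.sum_add_distrib, h, h', Pi.single_apply, Finset.sum_ite_eq', hi, hl, hi', hl',
    if_true, if_false] at hs hs'
  have : a = a' := by simpa using hs
  have : b = b' := by simpa using hs'
  subst_vars
  simpa using he

def NN (k : ℕ) (w : ZMod m) (t : Fin n → ZMod m) : ℝ :=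
  ((Finset.univ.filter fun U : Finset (Fin n) => U.card = k ∧ ∑ i ∈ U, t i = w).card : ℝ)

lemma NN_eq (k : ℕ) (w : ZMod m) (t : Fin n → ZMod m) :
    NN k w t = ∑ S ∈ Finset.powersetCard k (Finset.univ : Finset (Fin n)),
      if ∑ i ∈ S, t i = w then (1 : ℝ) else 0 := by
  unfold NN
  rw [Finset.sum_boole]
  congr 2
  ext S; simp

lemma sum_NN (k : ℕ) (hk : 1 ≤ k) (w : ZMod m) :
    (∑ t : Fin n → ZMod m, NN k w t) * m ≤ n.choose k * (m : ℝ) ^ n := by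
  simp only [NN_eq]
  rw [Finset.sum_comm, Finset.sum_mul]
  have : ∀ S ∈ Finset.powersetCard k (Finset.univ : Finset (Fin n)),
      (∑ t : Fin n → ZMod m, if ∑ i ∈ S, t i = w then (1 : ℝ) else 0) * m ≤ (m : ℝ) ^ n := by
    intro S hS
    rw [Finset.sum_boole]
    exact_mod_cast count1 w S (by
      rw [← Finset.card_pos, (Finset.mem_powersetCard.1 hS).2]; omega)
  refine (Finset.sum_le_sum this).trans ?_
  simp

lemma sum_NN2 (k : ℕ) (w : ZMod m) :
    (∑ t : Fin n → ZMod m, NN k w t * (NN k w t - 1)) * m ^ 2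
      ≤ (n.choose k : ℝ) ^ 2 * (m : ℝ) ^ n := by
  have hle : ∀ t : Fin n → ZMod m, NN k w t * (NN k w t - 1) ≤
      ∑ S ∈ Finset.powersetCard k (Finset.univ : Finset (Fin n)),
      ∑ S' ∈ Finset.powersetCard k (Finset.univ : Finset (Fin n)),
        if S ≠ S' then
          (if ∑ i ∈ S, t i = w ∧ ∑ i ∈ S', t i = w then (1 : ℝ) else 0) else 0 := by
    intro t
    rw [mul_sub, mul_one, sub_le_iff_le_add]
    have hN : NN k w t = ∑ S ∈ Finset.powersetCard k (Finset.univ : Finset (Fin n)),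
      ∑ S' ∈ Finset.powersetCard k (Finset.univ : Finset (Fin n)),
        if S = S' then (if ∑ i ∈ S, t i = w then (1 : ℝ) else 0) else 0 := by
      rw [NN_eq]
      refine Finset.sum_congr rfl fun S hS => ?_
      rw [Finset.sum_ite_eq]; simp only [hS, if_true]
    conv_rhs => rw [hN]
    rw [NN_eq, Finset.sum_mul_sum, ← Finset.sum_add_distrib]
    refine Finset.sum_le_sum fun S _ => ?_
    rw [← Finset.sum_add_distrib]
    refine Finset.sum_le_sum fun S' _ => ?_
    by_cases h : S = S'
    · subst h; by_cases h1 : ∑ i ∈ S, t i = w <;> simp [h1]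
    · by_cases h1 : ∑ i ∈ S, t i = w <;> by_cases h2 : ∑ i ∈ S', t i = w <;> simp [h, h1, h2]
  have h1 := Finset.sum_le_sum (fun t (_ : t ∈ (Finset.univ : Finset (Fin n → ZMod m))) => hle t)
  have h2 := mul_le_mul_of_nonneg_right h1 (by positivity : (0 : ℝ) ≤ (m : ℝ) ^ 2)
  refine h2.trans ?_
  rw [Finset.sum_comm, Finset.sum_mul]
  have : ∀ S ∈ Finset.powersetCard k (Finset.univ : Finset (Fin n)),
      (∑ t : Fin n → ZMod m, ∑ S' ∈ Finset.powersetCard k (Finset.univ : Finset (Fin n)),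
        if S ≠ S' then
          (if ∑ i ∈ S, t i = w ∧ ∑ i ∈ S', t i = w then (1 : ℝ) else 0) else 0) * m ^ 2
        ≤ n.choose k * (m : ℝ) ^ n := by
    intro S hS
    rw [Finset.sum_comm, Finset.sum_mul]
    have : ∀ S' ∈ Finset.powersetCard k (Finset.univ : Finset (Fin n)),
      (∑ t : Fin n → ZMod m, if S ≠ S' then
          (if ∑ i ∈ S, t i = w ∧ ∑ i ∈ S', t i = w then (1 : ℝ) else 0) else 0) * m ^ 2
        ≤ (m : ℝ) ^ n := by
      intro S' hS'
      by_cases h : S = S'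
      · simp [h]
      · simp only [ne_eq, h, not_false_eq_true, if_true]
        rw [Finset.sum_boole]
        exact_mod_cast count2 w S S' h (by
          rw [(Finset.mem_powersetCard.1 hS).2, (Finset.mem_powersetCard.1 hS').2])
    refine (Finset.sum_le_sum this).trans ?_
    simp
  refine (Finset.sum_le_sum this).trans ?_
  simp [sq, mul_assoc]
end count
end KS

namespace KS
section fin

lemma state_norm (M : ℕ) [NeZero M] (J W : Type) [Fintype J] [Fintype W]
    (U : ℕ → QSpace M J W ≃ₗᵢ[ℂ] QSpace M J W)
    (Oz : QSpace M J W ≃ₗᵢ[ℂ] QSpace M J W) (ψ0 : QSpace M J W) (t : ℕ) :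
    ‖stateAfter M J W U Oz ψ0 t‖ = ‖ψ0‖ := by
  induction t with
  | zero => simp [stateAfter]
  | succ t ih => simp [stateAfter, ih]

lemma nu_bound (n ℓ m j : ℕ) [NeZero m] [NeZero ℓ] (hn : j + 1 ≤ n) (W : Type) [Fintype W]
    (w : ZMod m) (T : ℕ) (U : ℕ → HH n ℓ m W ≃ₗᵢ[ℂ] HH n ℓ m W)
    (ψ0 : HH n ℓ m W) (hψ0 : ‖ψ0‖ = 1)
    (P : Option {S : Finset (Fin n) // S.card = j + 1} → HH n ℓ m W →L[ℂ] HH n ℓ m W)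
    (hsa : ∀ o, IsSelfAdjoint (P o))
    (hidem : ∀ o, (P o).comp (P o) = P o) (hsum : ∑ o, P o = 1) :
    let ν := ∑ t : Fin n → ZMod m, ∑ r : Fin n → Fin ℓ,
        plantedProb n (j + 1) m w t * ((1 : ℝ) / (ℓ : ℝ) ^ n) *
          ∑ S : {S : Finset (Fin n) // S.card = j + 1},
            (if ∑ i ∈ S.val, t i = w then
              ‖P (some S) (stateAfter (m + 1) (Fin n × Fin ℓ) W U
                    (oracle (m + 1) (encode n ℓ m t r)) ψ0 T)‖ ^ 2
            else 0)
    0 ≤ ν ∧ ν ≤ 1 ∧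
      ν ≤ (72 * 8 ^ j * (T / √ℓ) ^ (j + 2) + 2 * (j + 1) ^ 2) / n.choose (j + 1)
        + n.choose (j + 1) / m := by
  intro ν
  have hl : (0 : ℝ) < ℓ := by exact_mod_cast NeZero.pos ℓ
  have hm : (0 : ℝ) < m := by exact_mod_cast NeZero.pos m
  have hC : (0 : ℝ) < n.choose (j + 1) := by exact_mod_cast Nat.choose_pos hn
  set C : ℝ := ((n.choose (j + 1) : ℕ) : ℝ) with hCdef
  have hmn : (m : ℝ) ^ n = (m : ℝ) ^ (n - 1) * m := by
    rw [← pow_succ]; congr 1; omega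
  let s : (Fin n → ZMod m) → (Fin n → Fin ℓ) → ℝ := fun t r =>
    ∑ S : {S : Finset (Fin n) // S.card = j + 1},
            (if ∑ i ∈ S.val, t i = w then
              ‖P (some S) (stateAfter (m + 1) (Fin n × Fin ℓ) W U
                    (oracle (m + 1) (encode n ℓ m t r)) ψ0 T)‖ ^ 2
            else 0)
  have hs0 : ∀ t r, 0 ≤ s t r := fun t r => Finset.sum_nonneg fun S _ => by
    split_ifs <;> positivity
  have hs1 : ∀ t r, s t r ≤ 1 := by
    intro t r
    have h1 := meas_sum P hsa hidem hsum (stateAfter (m + 1) (Fin n × Fin ℓ) W U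
                    (oracle (m + 1) (encode n ℓ m t r)) ψ0 T)
    rw [state_norm, hψ0, one_pow] at h1
    refine le_trans (Finset.sum_le_sum fun S _ => ?_) h1
    split_ifs
    · exact le_rfl
    · positivity
  have hN0 : ∀ t : Fin n → ZMod m, 0 ≤ NN (j + 1) w t := fun t => Nat.cast_nonneg _
  have hN1 : ∀ t : Fin n → ZMod m, 0 ≤ NN (j + 1) w t * (NN (j + 1) w t - 1) := by
    intro t
    unfold NN
    generalize (Finset.univ.filter fun U : Finset (Fin n) =>
      U.card = j + 1 ∧ ∑ i ∈ U, t i = w).card = N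
    rcases N with _ | N
    · simp
    · push_cast; rw [add_sub_cancel_right]; positivity
  set K : ℝ := 1 / (C * (m : ℝ) ^ (n - 1) * (ℓ : ℝ) ^ n) with hK
  have hKpos : 0 < K := by positivity
  have hνK : ν = K * ∑ t, ∑ r, NN (j + 1) w t * s t r := by
    rw [Finset.mul_sum]
    refine Finset.sum_congr rfl fun t _ => ?_
    rw [Finset.mul_sum]
    refine Finset.sum_congr rfl fun r _ => ?_
    change NN (j + 1) w t / (C * (m : ℝ) ^ (n - 1)) * (1 / (ℓ : ℝ) ^ n) * s t r
      = K * (NN (j + 1) w t * s t r)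
    rw [hK]; field_simp
  have hsumS : ∑ t, ∑ r, s t r ≤
      ((ℓ : ℝ) * m) ^ n * ((72 * 8 ^ j * (T / √ℓ) ^ (j + 2) + 2 * (j + 1) ^ 2) / m) := by
    have h := prob_bound n ℓ m j W w T U ψ0 hψ0 P hsa hidem hsum
    refine le_trans (le_of_eq ?_) h
    rw [Finset.sum_comm, ← Fintype.sum_prod_type']
    exact (Fintype.sum_equiv (Equiv.arrowProdEquivProdArrow (Fin n) (fun _ => Fin ℓ)
      (fun _ => ZMod m)) _ _ (fun x => rfl)).symm
  refine ⟨?_, ?_, ?_⟩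
  · rw [hνK]
    exact mul_nonneg hKpos.le (Finset.sum_nonneg fun t _ => Finset.sum_nonneg fun r _ =>
      mul_nonneg (hN0 t) (hs0 t r))
  · have h1 : ∑ t, ∑ r, NN (j + 1) w t * s t r ≤
        ∑ t : Fin n → ZMod m, ∑ _r : Fin n → Fin ℓ, NN (j + 1) w t :=
      Finset.sum_le_sum fun t _ => Finset.sum_le_sum fun r _ =>
        mul_le_of_le_one_right (hN0 t) (hs1 t r)
    have h2 : ∑ t : Fin n → ZMod m, ∑ _r : Fin n → Fin ℓ, NN (j + 1) w t
        = (ℓ : ℝ) ^ n * ∑ t : Fin n → ZMod m, NN (j + 1) w t := by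
      simp [Finset.mul_sum]
    have h3 := sum_NN (n := n) (j + 1) (by omega) w
    rw [hmn, ← mul_assoc, ← hCdef] at h3
    have h4 := le_of_mul_le_mul_right h3 hm
    rw [hνK]
    calc _ ≤ K * ((ℓ : ℝ) ^ n * (C * (m : ℝ) ^ (n - 1))) := by
          rw [h2] at h1
          gcongr
          exact h1.trans (by gcongr)
      _ = 1 := by rw [hK]; field_simp
  · have h1 : ∑ t, ∑ r, NN (j + 1) w t * s t r ≤
        ∑ t, ∑ r, (s t r + NN (j + 1) w t * (NN (j + 1) w t - 1)) := by
      refine Finset.sum_le_sum fun t _ => Finset.sum_le_sum fun r _ => ?_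
      have a1 := hs0 t r
      have a2 := hs1 t r
      have a3 := hN1 t
      have a4 := hN0 t
      rcases le_total 1 (NN (j + 1) w t) with h | h
      · nlinarith [mul_nonneg (sub_nonneg.2 h) (sub_nonneg.2 a2),
          mul_nonneg (sub_nonneg.2 h) (sub_nonneg.2 h)]
      · nlinarith [mul_nonneg (sub_nonneg.2 h) a1]
    have h2 : ∑ t, ∑ r, (s t r + NN (j + 1) w t * (NN (j + 1) w t - 1))
        = ∑ t, ∑ r, s t r + (ℓ : ℝ) ^ n * ∑ t : Fin n → ZMod m,
          NN (j + 1) w t * (NN (j + 1) w t - 1) := by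
      simp [Finset.sum_add_distrib, Finset.mul_sum]
    have h3 := sum_NN2 (n := n) (j + 1) w
    rw [← hCdef, ← le_div_iff₀ (by positivity)] at h3
    rw [hνK]
    calc _ ≤ K * (((ℓ : ℝ) * m) ^ n * ((72 * 8 ^ j * (T / √ℓ) ^ (j + 2) + 2 * (j + 1) ^ 2) / m)
            + (ℓ : ℝ) ^ n * (C ^ 2 * (m : ℝ) ^ n / (m : ℝ) ^ 2)) := by
          rw [h2] at h1
          gcongr
          exact h1.trans (by gcongr)
      _ = _ := by
          rw [hK, mul_pow, hmn]
          field_simp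

lemma asymp (j : ℕ) (ℓ : ℕ → ℕ) (hℓ : ∀ n, 2 ≤ ℓ n) (m : ℕ → ℕ)
    (hm : Filter.Tendsto
      (fun n => (m n : ℝ) / (n : ℝ) ^ (((j + 1 : ℕ) : ℝ) + 2 / (((j + 1 : ℕ) : ℝ) + 1)))
      Filter.atTop Filter.atTop)
    (T : ℕ → ℕ) (ν : ℕ → ℝ)
    (hmain : ∀ n, j + 1 ≤ n → 0 ≤ ν n ∧ ν n ≤ 1 ∧
      ν n ≤ (72 * 8 ^ j * (T n / √(ℓ n)) ^ (j + 2) + 2 * (j + 1) ^ 2) / n.choose (j + 1)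
        + n.choose (j + 1) / m n)
    (hliminf : 0 < Filter.liminf ν Filter.atTop) :
    ∃ c : ℝ, 0 < c ∧ ∃ N : ℕ, ∀ n ≥ N,
      c * ν n * Real.sqrt ((ℓ n : ℝ) - 1) *
        (n : ℝ) ^ (((j + 1 : ℕ) : ℝ) / (((j + 1 : ℕ) : ℝ) + 1)) ≤ (T n : ℝ) := by
  set a : ℝ := Filter.liminf ν Filter.atTop / 2 with ha
  have hapos : 0 < a := by positivity
  have hbd : Filter.IsBoundedUnder (· ≥ ·) Filter.atTop ν :=
    Filter.isBoundedUnder_of_eventually_ge (a := 0)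
      (Filter.eventually_atTop.2 ⟨j + 1, fun n hn => (hmain n hn).1⟩)
  have hev : ∀ᶠ n in Filter.atTop, a < ν n :=
    Filter.eventually_lt_of_lt_liminf (by rw [ha]; linarith) hbd
  set F : ℝ := 2 ^ (j + 1) * ((j + 1).factorial : ℝ) with hF
  have hF1 : 1 ≤ F := by
    have h1 : (1 : ℝ) ≤ 2 ^ (j + 1) := one_le_pow₀ (by norm_num)
    have h2 : (1 : ℝ) ≤ ((j + 1).factorial : ℝ) := by exact_mod_cast Nat.factorial_pos _
    nlinarith
  have hFpos : 0 < F := by linarith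
  have hm4 := hm.eventually_ge_atTop (4 / a)
  have hn4 : ∀ᶠ n : ℕ in Filter.atTop, F * (2 * (j + 1) ^ 2) * (4 / a) ≤ (n : ℝ) :=
    tendsto_natCast_atTop_atTop.eventually_ge_atTop _
  have hall := ((hev.and hm4).and hn4).and (Filter.eventually_ge_atTop (2 * (j + 1)))
  obtain ⟨N, hN⟩ := Filter.eventually_atTop.1 hall
  set D : ℝ := 144 * 8 ^ j * F with hD
  have hD1 : 1 ≤ D := by
    have : (1 : ℝ) ≤ 8 ^ j := one_le_pow₀ (by norm_num)
    nlinarith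
  refine ⟨1 / D, by positivity, N, fun n hn => ?_⟩
  obtain ⟨⟨⟨h1, h2⟩, h3⟩, h4⟩ := hN n hn
  obtain ⟨p0, p1, p2⟩ := hmain n (by omega)
  have hl : (2 : ℝ) ≤ ℓ n := by exact_mod_cast hℓ n
  have hn0 : (0 : ℝ) < n := by exact_mod_cast (by omega : 0 < n)
  have hn1 : (1 : ℝ) ≤ n := by exact_mod_cast (by omega : 1 ≤ n)
  have hC : (0 : ℝ) < n.choose (j + 1) := by exact_mod_cast Nat.choose_pos (by omega)
  -- lower bound on the binomial
  have hClow : (n : ℝ) ^ (j + 1) ≤ F * n.choose (j + 1) := by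
    have h := Nat.pow_le_choose (α := ℝ) (j + 1) n
    rw [div_le_iff₀ (by positivity)] at h
    have h' : (n : ℝ) ≤ 2 * ((n + 1 - (j + 1) : ℕ) : ℝ) := by
      exact_mod_cast (by omega : n ≤ 2 * (n + 1 - (j + 1)))
    calc (n : ℝ) ^ (j + 1) ≤ (2 * ((n + 1 - (j + 1) : ℕ) : ℝ)) ^ (j + 1) := by gcongr
      _ = 2 ^ (j + 1) * ((n + 1 - (j + 1) : ℕ) : ℝ) ^ (j + 1) := by rw [mul_pow]
      _ ≤ 2 ^ (j + 1) * (n.choose (j + 1) * ((j + 1).factorial : ℝ)) := by gcongr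
      _ = _ := by rw [hF]; ring
  have hCup : (n.choose (j + 1) : ℝ) ≤ (n : ℝ) ^ (j + 1) := by
    exact_mod_cast Nat.choose_le_pow n (j + 1)
  have hCn : (n : ℝ) ≤ F * n.choose (j + 1) :=
    (le_self_pow₀ hn1 (by omega)).trans hClow
  -- small terms
  have s1 : (2 * ((j : ℝ) + 1) ^ 2) / n.choose (j + 1) ≤ a / 4 := by
    rw [div_le_iff₀ hC]
    have := h3.trans hCn
    have h5 : (2 * ((j : ℝ) + 1) ^ 2) * (4 / a) ≤ n.choose (j + 1) := by
      refine le_of_mul_le_mul_left ?_ hFpos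
      linarith
    rw [← mul_div_assoc, div_le_iff₀ hapos] at h5
    linarith
  have s2 : (n.choose (j + 1) : ℝ) / m n ≤ a / 4 := by
    have hp : (0 : ℝ) < (n : ℝ) ^ (((j + 1 : ℕ) : ℝ) + 2 / (((j + 1 : ℕ) : ℝ) + 1)) := by positivity
    rw [le_div_iff₀ hp] at h2
    have h5 : (n : ℝ) ^ (j + 1) ≤
        (n : ℝ) ^ (((j + 1 : ℕ) : ℝ) + 2 / (((j + 1 : ℕ) : ℝ) + 1)) := by
      rw [← Real.rpow_natCast]
      exact Real.rpow_le_rpow_of_exponent_le hn1 (le_add_of_nonneg_right (by positivity))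
    have h6 : 4 / a * n.choose (j + 1) ≤ m n := by
      refine le_trans ?_ h2
      gcongr
      exact hCup.trans h5
    have hmp : (0 : ℝ) < m n := lt_of_lt_of_le (by positivity) h6
    rw [div_le_iff₀ hmp]
    rw [div_mul_eq_mul_div, div_le_iff₀ hapos] at h6
    linarith
  set τ : ℝ := T n / √(ℓ n) with hτ
  have hτ0 : 0 ≤ τ := by positivity
  have k1 : ν n * n.choose (j + 1) ≤ 144 * 8 ^ j * τ ^ (j + 2) := by
    rw [add_div] at p2
    have : ν n / 2 ≤ 72 * 8 ^ j * τ ^ (j + 2) / n.choose (j + 1) := by linarith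
    rw [le_div_iff₀ hC] at this
    linarith
  have k2 : ν n * (n : ℝ) ^ (j + 1) ≤ D * τ ^ (j + 2) := by
    calc _ ≤ ν n * (F * n.choose (j + 1)) := by gcongr
      _ = F * (ν n * n.choose (j + 1)) := by ring
      _ ≤ F * (144 * 8 ^ j * τ ^ (j + 2)) := by gcongr
      _ = _ := by rw [hD]; ring
  set y : ℝ := (n : ℝ) ^ (((j + 1 : ℕ) : ℝ) / (((j + 1 : ℕ) : ℝ) + 1)) with hy
  have hy0 : 0 ≤ y := by positivity
  have hyp : y ^ (j + 2) = (n : ℝ) ^ (j + 1) := by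
    rw [hy, ← Real.rpow_natCast, ← Real.rpow_mul hn0.le, ← Real.rpow_natCast]
    congr 1
    push_cast
    have : (j : ℝ) + 1 + 1 ≠ 0 := by positivity
    field_simp
    ring
  have k3 : ν n * y ≤ D * τ := by
    refine le_of_pow_le_pow_left₀ (n := j + 2) (by omega) (by positivity) ?_
    rw [mul_pow, hyp, mul_pow]
    calc _ ≤ ν n * (n : ℝ) ^ (j + 1) := by
          gcongr
          exact pow_le_of_le_one p0 p1 (by omega)
      _ ≤ D * τ ^ (j + 2) := k2
      _ ≤ _ := by
          gcongr
          exact le_self_pow₀ hD1 (by omega)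
  have hsq : √((ℓ n : ℝ) - 1) ≤ √(ℓ n) := Real.sqrt_le_sqrt (by linarith)
  have hT : τ * √(ℓ n) = T n := by
    rw [hτ]; have : √(ℓ n : ℝ) ≠ 0 := by positivity
    field_simp
  calc _ = (1 / D * (ν n * y)) * √((ℓ n : ℝ) - 1) := by ring
    _ ≤ (1 / D * (D * τ)) * √(ℓ n) := by gcongr
    _ = τ * √(ℓ n) := by field_simp
    _ = T n := hT
end fin
end KS

/-- Fix `k ≥ 1`.  For each `n` let `ℓ_n ≥ 2` and `m_n` be integers with
`m_n / n^{k+2/(k+1)} → ∞`, let `w_n ∈ ℤ/m_nℤ`, and let `𝒮_n` be a `T_n`-query quantum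
algorithm for the search version of `k-SUM ∘ pSEARCH_{ℓ_n}ⁿ` (oracle access to the
bucket encoding, followed by a projective measurement whose outcomes are `k`-subsets of
`{1,…,n}` plus failure).  Let `ν_n` be the probability, averaged over the planted
composed distribution, that the measured `k`-subset `S` satisfies `∑_{i∈S} t_i = w_n`.
If `liminf ν_n > 0`, then there are `c > 0` and `N` with
`T_n ≥ c ν_n √(ℓ_n - 1) n^{k/(k+1)}` for all `n ≥ N`. -/
theorem stmt18 (k : ℕ) (hk : 1 ≤ k)
    (ℓ : ℕ → ℕ) (hℓ : ∀ n, 2 ≤ ℓ n)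
    (m : ℕ → ℕ) [∀ n, NeZero (m n)]
    (hm : Filter.Tendsto
      (fun n => (m n : ℝ) / (n : ℝ) ^ ((k : ℝ) + 2 / ((k : ℝ) + 1)))
      Filter.atTop Filter.atTop)
    (w : ∀ n, ZMod (m n))
    (T : ℕ → ℕ)
    (W : ℕ → Type) [∀ n, Fintype (W n)] [∀ n, DecidableEq (W n)]
    (U : ∀ n, ℕ → (QSpace (m n + 1) (Fin n × Fin (ℓ n)) (W n) ≃ₗᵢ[ℂ]
      QSpace (m n + 1) (Fin n × Fin (ℓ n)) (W n)))
    (e0 : ∀ n, QIdx (m n + 1) (Fin n × Fin (ℓ n)) (W n))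
    (Proj : ∀ n, Option {S : Finset (Fin n) // S.card = k} →
      (QSpace (m n + 1) (Fin n × Fin (ℓ n)) (W n) →L[ℂ]
        QSpace (m n + 1) (Fin n × Fin (ℓ n)) (W n)))
    (hsa : ∀ n o, IsSelfAdjoint (Proj n o))
    (hidem : ∀ n o, (Proj n o).comp (Proj n o) = Proj n o)
    (horth : ∀ n o o', o ≠ o' → (Proj n o).comp (Proj n o') = 0)
    (hsum : ∀ n, ∑ o, Proj n o = 1)
    (ν : ℕ → ℝ)
    (hν : ∀ n, ν n = ∑ t : Fin n → ZMod (m n), ∑ r : Fin n → Fin (ℓ n),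
        plantedProb n k (m n) (w n) t * ((1 : ℝ) / (ℓ n : ℝ) ^ n) *
          ∑ S : {S : Finset (Fin n) // S.card = k},
            (if ∑ i ∈ S.val, t i = w n then
              ‖Proj n (some S)
                  (stateAfter (m n + 1) (Fin n × Fin (ℓ n)) (W n) (U n)
                    (oracle (m n + 1) (encode n (ℓ n) (m n) t r))
                    (EuclideanSpace.single (e0 n) 1) (T n))‖ ^ 2
            else 0))
    (hliminf : 0 < Filter.liminf ν Filter.atTop) :
    ∃ c : ℝ, 0 < c ∧ ∃ N : ℕ, ∀ n ≥ N,
      c * ν n * Real.sqrt ((ℓ n : ℝ) - 1) * (n : ℝ) ^ ((k : ℝ) / ((k : ℝ) + 1))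
        ≤ (T n : ℝ) := by
  obtain ⟨j, rfl⟩ : ∃ j, k = j + 1 := ⟨k - 1, by omega⟩
  have hmain : ∀ n, j + 1 ≤ n → 0 ≤ ν n ∧ ν n ≤ 1 ∧
      ν n ≤ (72 * 8 ^ j * (T n / √(ℓ n)) ^ (j + 2) + 2 * (j + 1) ^ 2) / n.choose (j + 1)
        + n.choose (j + 1) / m n := by
    intro n hn
    haveI : NeZero (ℓ n) := ⟨by have := hℓ n; omega⟩
    rw [hν n]
    exact KS.nu_bound n (ℓ n) (m n) j hn (W n) (w n) (T n) (U n)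
      (EuclideanSpace.single (e0 n) 1) (by simp) (Proj n) (hsa n) (hidem n) (hsum n)
  exact KS.asymp j ℓ hℓ m hm T ν hmain hliminf

end
end
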